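/- arXiv:2107.10613 — 2 statements merged into one kernel-verified Lean document; each statement's English description precedes it below -/
import Mathlib

section
/- Let α, β ∈ (0,1) be irrational. The suspension spaces of the two-sided Sturmian subshifts (Λ_α, σ_α) and (Λ_β, σ_β) are homeomorphic if and only if α ∼ β, i.e. α and β are equivalent irrationals. -/
noncomputable section

open Set

/-! ### Sturmian sequences and subshifts -/

/-- The Sturmian coding of a real number `t`: `false` (the symbol `0`) if the fractional
part of `t` lies in `[0, 1 - α)`, and `true` (the symbol `1`) if it lies in `[1 - α, 1)`. -/
def sturmianCode (α t : ℝ) : Bool := decide (1 - α ≤ Int.fract t)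

/-- The one-sided Sturmian sequence with parameter `α` and starting point `t`,
i.e. `i ↦ I_α (R_α^i t)`. -/
def sturmianSeqN (α t : ℝ) : ℕ → Bool := fun i => sturmianCode α (t + i * α)

/-- The one-sided Sturmian subshift `X_α`. -/
def sturmianN (α : ℝ) : Set (ℕ → Bool) := closure {x | ∃ t : ℝ, x = sturmianSeqN α t}

/-- The two-sided Sturmian sequence with parameter `α` and starting point `t`. -/
def sturmianSeqZ (α t : ℝ) : ℤ → Bool := fun i => sturmianCode α (t + i * α)

/-- The two-sided Sturmian subshift `Λ_α`. -/
def sturmianZ (α : ℝ) : Set (ℤ → Bool) := closure {x | ∃ t : ℝ, x = sturmianSeqZ α t}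

/-- The shift on one-sided sequences. -/
def shiftN {A : Type*} (x : ℕ → A) : ℕ → A := fun i => x (i + 1)

/-- The shift on two-sided sequences. -/
def shiftZ {A : Type*} (x : ℤ → A) : ℤ → A := fun i => x (i + 1)

lemma continuous_shiftN {A : Type*} [TopologicalSpace A] :
    Continuous (shiftN (A := A)) := continuous_pi fun i => continuous_apply (i + 1)

lemma continuous_shiftZ {A : Type*} [TopologicalSpace A] :
    Continuous (shiftZ (A := A)) := continuous_pi fun i => continuous_apply (i + 1)

lemma sturmianN_shift_mem {α : ℝ} {x : ℕ → Bool} (hx : x ∈ sturmianN α) :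
    shiftN x ∈ sturmianN α := by
  have h : MapsTo shiftN {x : ℕ → Bool | ∃ t : ℝ, x = sturmianSeqN α t}
      {x : ℕ → Bool | ∃ t : ℝ, x = sturmianSeqN α t} := by
    rintro x ⟨t, rfl⟩
    refine ⟨t + α, ?_⟩
    funext i
    show sturmianCode α (t + (↑(i + 1) : ℝ) * α) = sturmianCode α (t + α + (i : ℝ) * α)
    congr 1
    push_cast
    ring
  exact h.closure continuous_shiftN hx

lemma sturmianZ_shift_mem {α : ℝ} {x : ℤ → Bool} (hx : x ∈ sturmianZ α) :
    shiftZ x ∈ sturmianZ α := by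
  have h : MapsTo shiftZ {x : ℤ → Bool | ∃ t : ℝ, x = sturmianSeqZ α t}
      {x : ℤ → Bool | ∃ t : ℝ, x = sturmianSeqZ α t} := by
    rintro x ⟨t, rfl⟩
    refine ⟨t + α, ?_⟩
    funext i
    show sturmianCode α (t + (↑(i + 1) : ℝ) * α) = sturmianCode α (t + α + (i : ℝ) * α)
    congr 1
    push_cast
    ring
  exact h.closure continuous_shiftZ hx

/-- The shift map `σ_α : X_α → X_α` of the one-sided Sturmian subshift. -/
def sturmianShiftN (α : ℝ) (x : ↥(sturmianN α)) : ↥(sturmianN α) :=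
  ⟨shiftN x.1, sturmianN_shift_mem x.2⟩

/-- The shift map `σ_α : Λ_α → Λ_α` of the two-sided Sturmian subshift. -/
def sturmianShiftZ (α : ℝ) (x : ↥(sturmianZ α)) : ↥(sturmianZ α) :=
  ⟨shiftZ x.1, sturmianZ_shift_mem x.2⟩

/-- The branch point `ω_α` of the one-sided Sturmian subshift (corresponding to `t = α`). -/
def sturmianBranch (α : ℝ) : ℕ → Bool := sturmianSeqN α α

/-- The orbit `orb_α(x) = ⋃_{k,l} σ_α^{-l}(σ_α^k(x))` of a point of `X_α`. -/
def sturmianOrbN (α : ℝ) (x : ℕ → Bool) : Set (ℕ → Bool) :=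
  {y | y ∈ sturmianN α ∧ ∃ k l : ℕ, shiftN^[l] y = shiftN^[k] x}

/-- The forward orbit `orb⁺_α(x) = {σ_α^k(x) : k ∈ ℕ}`. -/
def sturmianOrbPlus (α : ℝ) (x : ℕ → Bool) : Set (ℕ → Bool) :=
  {y | ∃ k : ℕ, y = shiftN^[k] x}

/-- The orbit `{σ^n(x) : n ∈ ℤ}` of a two-sided sequence under the shift:
`σ^n(x) = (i ↦ x (i + n))`. -/
def orbitZ {A : Type*} (x : ℤ → A) : Set (ℤ → A) := {y | ∃ n : ℤ, y = fun i => x (i + n)}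

/-- Equivalence of irrationals: `α ∼ β` iff `β = (aα+b)/(cα+d)` with `ad - bc = ±1`. -/
def IrrationalEquiv (α β : ℝ) : Prop :=
  ∃ a b c d : ℤ, (a * d - b * c = 1 ∨ a * d - b * c = -1) ∧
    β = ((a : ℝ) * α + b) / ((c : ℝ) * α + d)

/-- The subgroup `ℤ + αℤ = {m + nα : m, n ∈ ℤ}` of `ℝ`, as an ordered abelian group with
the order inherited from `ℝ`. -/
def ZplusAZ (α : ℝ) : AddSubgroup ℝ where
  carrier := {x | ∃ m n : ℤ, x = (m : ℝ) + n * α}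
  add_mem' := by
    rintro x y ⟨m, n, rfl⟩ ⟨m', n', rfl⟩
    exact ⟨m + m', n + n', by push_cast; ring⟩
  zero_mem' := ⟨0, 0, by norm_num⟩
  neg_mem' := by
    rintro x ⟨m, n, rfl⟩
    exact ⟨-m, -n, by push_cast; ring⟩

lemma one_mem_ZplusAZ (α : ℝ) : (1 : ℝ) ∈ ZplusAZ α := ⟨1, 0, by norm_num⟩

/-! ### Suspension and flow -/

/-- The relation `(x, s+1) ∼ (σ_α x, s)` generating the suspension of `(Λ_α, σ_α)`. -/
def suspRel (α : ℝ) (p q : ↥(sturmianZ α) × ℝ) : Prop :=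
  ∃ (x : ↥(sturmianZ α)) (s : ℝ), p = (x, s + 1) ∧ q = (sturmianShiftZ α x, s)

/-- The suspension (mapping torus) of the two-sided Sturmian subshift `(Λ_α, σ_α)`:
the quotient of `Λ_α × ℝ` by the equivalence relation generated by `(x,s+1) ∼ (σ_α x, s)`. -/
def Suspension (α : ℝ) : Type := Quot (suspRel α)

instance (α : ℝ) : TopologicalSpace (Suspension α) := by
  unfold Suspension; infer_instance

/-- The flow `φ_{s'}[x,s] = [x, s + s']` on the suspension. -/
def suspFlow (α : ℝ) (s' : ℝ) : Suspension α → Suspension α :=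
  Quot.map (fun p => (p.1, p.2 + s'))
    (by
      rintro p q ⟨x, s, rfl, rfl⟩
      exact ⟨x, s + s', by show (x, s + 1 + s') = (x, s + s' + 1); rw [add_right_comm s 1 s'], rfl⟩)

/-- Flow equivalence of two Sturmian subshifts: a homeomorphism of the suspensions mapping
each flow orbit onto a flow orbit, preserving the forward direction of the flow. -/
def SturmianFlowEquiv (α β : ℝ) : Prop :=
  ∃ h : Suspension α ≃ₜ Suspension β, ∀ u : Suspension α, ∃ c : ℝ → ℝ,
    StrictMono c ∧ Function.Surjective c ∧
      ∀ s : ℝ, h (suspFlow α s u) = suspFlow β (c s) (h u)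

/-! ### Words and pasts -/

/-- Prepend a letter to a one-sided sequence. -/
def consSeq {A : Type*} (a : A) (x : ℕ → A) : ℕ → A := fun i => if i = 0 then a else x (i - 1)

/-- Prepend a finite word (a list) to a one-sided sequence: `μx`. -/
def wordCat {A : Type*} (μ : List A) (x : ℕ → A) : ℕ → A := μ.foldr consSeq x

/-- The set `P_l(x)` of `l`-pasts of `x` relative to a subshift `X`. -/
def past {A : Type*} (X : Set (ℕ → A)) (l : ℕ) (x : ℕ → A) : Set (List A) :=
  {μ | μ.length = l ∧ wordCat μ x ∈ X}

/-- `x` is isolated in `l`-past equivalence in `X`. -/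
def IsolatedInPast {A : Type*} (X : Set (ℕ → A)) (l : ℕ) (x : ℕ → A) : Prop :=
  ∀ y ∈ X, past X l y = past X l x → y = x


lemma shiftN_consSeq {A : Type*} (a : A) (x : ℕ → A) : shiftN (consSeq a x) = x := by
  funext i; simp [shiftN, consSeq]

lemma consSeq_shiftN {A : Type*} (x : ℕ → A) : consSeq (x 0) (shiftN x) = x := by
  funext i; cases i <;> simp [consSeq, shiftN]

lemma shiftN_iterate_apply {A : Type*} (x : ℕ → A) (k i : ℕ) : shiftN^[k] x i = x (i + k) := by
  induction k generalizing x i with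
  | zero => rfl
  | succ k ih =>
    rw [Function.iterate_succ_apply, ih (shiftN x) i]
    show x (i + k + 1) = x (i + (k + 1))
    ring_nf

lemma shiftN_iterate_wordCat {A : Type*} (μ : List A) (x : ℕ → A) :
    shiftN^[μ.length] (wordCat μ x) = x := by
  induction μ with
  | nil => rfl
  | cons a μ ih =>
    show shiftN^[μ.length + 1] (consSeq a (wordCat μ x)) = x
    rw [Function.iterate_succ_apply, shiftN_consSeq, ih]

lemma wordCat_append {A : Type*} (μ ν : List A) (x : ℕ → A) :
    wordCat (μ ++ ν) x = wordCat μ (wordCat ν x) := by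
  simp [wordCat, List.foldr_append]

lemma shiftN_mem_of_image {A : Type*} {X : Set (ℕ → A)} (hX : shiftN '' X = X)
    {x : ℕ → A} (hx : x ∈ X) : shiftN x ∈ X := by
  rw [← hX]; exact ⟨x, hx, rfl⟩

lemma shiftN_iterate_mem_of_image {A : Type*} {X : Set (ℕ → A)} (hX : shiftN '' X = X)
    {x : ℕ → A} (hx : x ∈ X) (k : ℕ) : shiftN^[k] x ∈ X := by
  induction k generalizing x with
  | zero => exact hx
  | succ k ih =>
    rw [Function.iterate_succ_apply]
    exact ih (shiftN_mem_of_image hX hx)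

lemma exists_word_extension {A : Type*} {X : Set (ℕ → A)} (hX : shiftN '' X = X)
    {z : ℕ → A} (hz : z ∈ X) (d : ℕ) : ∃ ν : List A, ν.length = d ∧ wordCat ν z ∈ X := by
  induction d with
  | zero => exact ⟨[], rfl, hz⟩
  | succ d ih =>
    obtain ⟨ν, hlen, hν⟩ := ih
    have : wordCat ν z ∈ shiftN '' X := by rw [hX]; exact hν
    obtain ⟨w, hw, hweq⟩ := this
    refine ⟨w 0 :: ν, by simp [hlen], ?_⟩
    show consSeq (w 0) (wordCat ν z) ∈ X
    rw [← hweq, consSeq_shiftN]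
    exact hw

lemma past_mono {A : Type*} {X : Set (ℕ → A)} (hX : shiftN '' X = X) {m l : ℕ} (hml : m ≤ l)
    {z z' : ℕ → A} (h : past X l z = past X l z') : past X m z = past X m z' := by
  have key : ∀ w w' : ℕ → A, past X l w ⊆ past X l w' → past X m w ⊆ past X m w' := by
    intro w w' hsub μ hμ
    obtain ⟨hlen, hmem⟩ := hμ
    obtain ⟨ν, hνlen, hνmem⟩ := exists_word_extension hX hmem (l - m)
    rw [← wordCat_append] at hνmem
    have hin : ν ++ μ ∈ past X l w := ⟨by simp [hνlen, hlen]; omega, hνmem⟩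
    have hout := hsub hin
    obtain ⟨-, hmem'⟩ := hout
    rw [wordCat_append] at hmem'
    have := shiftN_iterate_mem_of_image hX hmem' ν.length
    rw [shiftN_iterate_wordCat] at this
    exact ⟨hlen, this⟩
  exact subset_antisymm (key z z' h.subset) (key z' z h.symm.subset)

/-- prefix word of length `d` -/
def prefixWord {A : Type*} (x : ℕ → A) (d : ℕ) : List A := (List.range d).map x

lemma wordCat_prefixWord {A : Type*} (x : ℕ → A) (d : ℕ) :
    wordCat (prefixWord x d) (shiftN^[d] x) = x := by
  induction d generalizing x with
  | zero => rfl
  | succ d ih =>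
    have h1 : prefixWord x (d + 1) = x 0 :: prefixWord (shiftN x) d := by
      show (List.range (d+1)).map x = _
      rw [List.range_succ_eq_map, List.map_cons, List.map_map]
      rfl
    rw [h1, Function.iterate_succ_apply]
    show consSeq (x 0) (wordCat (prefixWord (shiftN x) d) (shiftN^[d] (shiftN x))) = x
    rw [ih (shiftN x), consSeq_shiftN]

lemma prefixWord_length {A : Type*} (x : ℕ → A) (d : ℕ) : (prefixWord x d).length = d := by
  simp [prefixWord]

lemma past_wordCat {A : Type*} {X : Set (ℕ → A)} (τ : List A) (z : ℕ → A) (m : ℕ) (μ : List A) :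
    μ ∈ past X m (wordCat τ z) ↔ μ ++ τ ∈ past X (m + τ.length) z := by
  constructor
  · rintro ⟨hlen, hmem⟩
    exact ⟨by simp [hlen], by rwa [wordCat_append]⟩
  · rintro ⟨hlen, hmem⟩
    rw [wordCat_append] at hmem
    refine ⟨?_, hmem⟩
    simp at hlen; omega

/-- Monotonicity of `∼_{k,l}` under the order `⪯`. -/
lemma sim_mono {A : Type*} {X : Set (ℕ → A)} (hX : shiftN '' X = X)
    {k₁ l₁ k₂ l₂ : ℕ} (hk : k₁ ≤ k₂) (hl : l₁ - k₁ ≤ l₂ - k₂) (hkl₁ : k₁ ≤ l₁) (hkl₂ : k₂ ≤ l₂)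
    {x y : ℕ → A}
    (h1 : ∀ i < k₂, x i = y i)
    (h2 : past X l₂ (shiftN^[k₂] x) = past X l₂ (shiftN^[k₂] y)) :
    (∀ i < k₁, x i = y i) ∧ past X l₁ (shiftN^[k₁] x) = past X l₁ (shiftN^[k₁] y) := by
  refine ⟨fun i hi => h1 i (lt_of_lt_of_le hi hk), ?_⟩
  set d := k₂ - k₁ with hd
  have hx : shiftN^[k₁] x = wordCat (prefixWord (shiftN^[k₁] x) d) (shiftN^[k₂] x) := by
    have := wordCat_prefixWord (shiftN^[k₁] x) d
    rw [← Function.iterate_add_apply, show d + k₁ = k₂ by omega] at this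
    exact this.symm
  have hy : shiftN^[k₁] y = wordCat (prefixWord (shiftN^[k₁] y) d) (shiftN^[k₂] y) := by
    have := wordCat_prefixWord (shiftN^[k₁] y) d
    rw [← Function.iterate_add_apply, show d + k₁ = k₂ by omega] at this
    exact this.symm
  have hτ : prefixWord (shiftN^[k₁] x) d = prefixWord (shiftN^[k₁] y) d := by
    unfold prefixWord
    refine List.map_congr_left ?_
    intro j hj
    rw [List.mem_range] at hj
    rw [shiftN_iterate_apply, shiftN_iterate_apply]
    exact h1 (j + k₁) (by omega)
  have hpast : past X (l₁ + d) (shiftN^[k₂] x) = past X (l₁ + d) (shiftN^[k₂] y) :=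
    past_mono hX (by omega) h2
  ext μ
  rw [hx, hy, ← hτ, past_wordCat, past_wordCat, prefixWord_length, hpast]

/-- The Sturmian subshift is invariant: `σ(X_α) = X_α`. -/
lemma sturmianN_shift_image (α : ℝ) : shiftN '' sturmianN α = sturmianN α := by
  apply subset_antisymm
  · rintro y ⟨x, hx, rfl⟩
    exact sturmianN_shift_mem hx
  · have hcompact : IsCompact (sturmianN α) := isClosed_closure.isCompact
    have hcl : IsClosed (shiftN '' sturmianN α) :=
      (hcompact.image continuous_shiftN).isClosed
    have hsub : {x : ℕ → Bool | ∃ t : ℝ, x = sturmianSeqN α t} ⊆ shiftN '' sturmianN α := by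
      rintro x ⟨t, rfl⟩
      refine ⟨sturmianSeqN α (t - α), subset_closure ⟨t - α, rfl⟩, ?_⟩
      funext i
      show sturmianCode α (t - α + (↑(i + 1) : ℝ) * α) = sturmianCode α (t + (i : ℝ) * α)
      congr 1
      push_cast
      ring
    exact closure_minimal hsub hcl

/-! ### The cover of a one-sided subshift -/

/-- The equivalence relation `∼_{k,l}` on a subshift `X`:
`x ∼_{k,l} x'` iff `x_{[0,k)} = x'_{[0,k)}` and `P_l(σ^k x) = P_l(σ^k x')`. -/
def coverSetoid {A : Type*} (X : Set (ℕ → A)) (k l : ℕ) : Setoid ↥X where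
  r x y := (∀ i < k, x.1 i = y.1 i) ∧
    past X l (shiftN^[k] x.1) = past X l (shiftN^[k] y.1)
  iseqv := ⟨fun _ => ⟨fun _ _ => rfl, rfl⟩,
    fun h => ⟨fun i hi => (h.1 i hi).symm, h.2.symm⟩,
    fun h h' => ⟨fun i hi => (h.1 i hi).trans (h'.1 i hi), h.2.trans h'.2⟩⟩

/-- The index set `I = {(k,l) ∈ ℕ × ℕ : k ≤ l}`. -/
def CoverIdx : Type := {p : ℕ × ℕ // p.1 ≤ p.2}

/-- The partial order `⪯` on the index set: `(k₁,l₁) ⪯ (k₂,l₂)` iff `k₁ ≤ k₂` and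
`l₁ - k₁ ≤ l₂ - k₂`. -/
def CoverIdx.le (p q : CoverIdx) : Prop :=
  p.1.1 ≤ q.1.1 ∧ p.1.2 - p.1.1 ≤ q.1.2 - q.1.1

/-- The cover `X̃` of a one-sided subshift `X`: the projective limit of the finite
quotients `X/∼_{k,l}` over the directed set `I`, realised as the set of coherent families
of equivalence classes.  A family is coherent if any representative at an index `q` is also
a representative at every index `p ⪯ q`. -/
def SubshiftCover {A : Type*} (X : Set (ℕ → A)) : Type _ :=
  {f : (p : CoverIdx) → Quotient (coverSetoid X p.1.1 p.1.2) //
    ∀ p q : CoverIdx, CoverIdx.le p q → ∀ x : ↥X,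
      f q = Quotient.mk (coverSetoid X q.1.1 q.1.2) x →
      f p = Quotient.mk (coverSetoid X p.1.1 p.1.2) x}

instance {A : Type*} [TopologicalSpace A] (X : Set (ℕ → A)) :
    TopologicalSpace (SubshiftCover X) := by
  unfold SubshiftCover; infer_instance

/-- The factor map `π : X̃ → X` (with values in the ambient space `A^ℕ`): the `n`-th letter
of `π(xt)` is the `n`-th letter of any `(n+1, n+1)`-representative of `xt`. -/
def coverProj {A : Type*} {X : Set (ℕ → A)} (f : SubshiftCover X) : ℕ → A := fun n =>
  Quotient.lift (fun x : ↥X => x.1 n)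
    (by intro a b h; obtain ⟨h1, -⟩ := h; exact h1 n (Nat.lt_succ_self n))
    (f.1 ⟨(n + 1, n + 1), le_refl _⟩)

/-- The shift `σ̃ : X̃ → X̃` induced on the cover: the `(k,l)`-coordinate of `σ̃(xt)` is the
class of `σ(x)` for a `(k+1, l+1)`-representative `x` of `xt`. -/
def coverShift {A : Type*} {X : Set (ℕ → A)} (hX : shiftN '' X = X)
    (f : SubshiftCover X) : SubshiftCover X :=
  ⟨fun p => Quotient.lift
      (fun x : ↥X => Quotient.mk (coverSetoid X p.1.1 p.1.2)
        ⟨shiftN x.1, shiftN_mem_of_image hX x.2⟩)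
      (by
        intro a b h
        obtain ⟨h1, h2⟩ := h
        apply Quotient.sound
        constructor
        · intro i hi
          exact h1 (i + 1) (Nat.succ_lt_succ hi)
        · show past X p.1.2 (shiftN^[p.1.1] (shiftN a.1)) =
            past X p.1.2 (shiftN^[p.1.1] (shiftN b.1))
          rw [← Function.iterate_succ_apply, ← Function.iterate_succ_apply]
          exact past_mono hX (Nat.le_succ p.1.2) h2)
      (f.1 ⟨(p.1.1 + 1, p.1.2 + 1), Nat.succ_le_succ p.2⟩),
    by
      intro p q hpq y hy
      obtain ⟨x, hx⟩ := Quotient.exists_rep (f.1 ⟨(q.1.1 + 1, q.1.2 + 1), Nat.succ_le_succ q.2⟩)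
      have hq' : f.1 ⟨(p.1.1 + 1, p.1.2 + 1), Nat.succ_le_succ p.2⟩ =
          Quotient.mk (coverSetoid X (p.1.1 + 1) (p.1.2 + 1)) x := by
        refine f.2 _ ⟨(q.1.1 + 1, q.1.2 + 1), Nat.succ_le_succ q.2⟩ ?_ x hx.symm
        refine ⟨Nat.succ_le_succ hpq.1, ?_⟩
        show p.1.2 + 1 - (p.1.1 + 1) ≤ q.1.2 + 1 - (q.1.1 + 1)
        have := hpq.2; omega
      beta_reduce at hy ⊢
      rw [← hx] at hy
      rw [hq']
      obtain ⟨h1, h2⟩ := Quotient.exact hy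
      exact Quotient.sound (sim_mono hX hpq.1 hpq.2 p.2 q.2 h1 h2)⟩

/-- The section `ι : X → X̃`, sending `x` to the family of its own classes. -/
def coverIota {A : Type*} {X : Set (ℕ → A)} (hX : shiftN '' X = X) (x : ↥X) :
    SubshiftCover X :=
  ⟨fun p => Quotient.mk (coverSetoid X p.1.1 p.1.2) x, by
    intro p q hpq y hy
    obtain ⟨h1, h2⟩ := Quotient.exact hy
    exact Quotient.sound (sim_mono hX hpq.1 hpq.2 p.2 q.2 h1 h2)⟩

/-! ### Height functions of binary sequences -/

/-- The height function of a two-sided binary sequence: `height x 0 = 0` and the increment from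
`n` to `n + 1` is the `n`-th letter of `x`. -/
def height (x : ℤ → Bool) : ℤ → ℤ
  | Int.ofNat n => ∑ i ∈ Finset.range n, (x i).toInt
  | Int.negSucc n => -∑ i ∈ Finset.range (n + 1), (x (-(i : ℤ) - 1)).toInt

lemma height_zero (x : ℤ → Bool) : height x 0 = 0 := by
  show ∑ i ∈ Finset.range 0, (x i).toInt = 0
  simp

lemma height_add_one (x : ℤ → Bool) (n : ℤ) : height x (n + 1) = height x n + (x n).toInt := by
  rcases n with n | n
  · exact Finset.sum_range_succ (fun i : ℕ => (x i).toInt) n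
  · have hn : Int.negSucc n = -(n : ℤ) - 1 := by omega
    rcases n with _ | n
    · have : Int.negSucc 0 + 1 = 0 := rfl
      rw [this, height_zero]
      simp [height]
    · have : Int.negSucc (n + 1) + 1 = Int.negSucc n := by omega
      rw [this]
      simp only [height]
      rw [Finset.sum_range_succ _ (n + 1), hn]
      ring

lemma eq_of_increments_eq {f g : ℤ → ℤ} (h0 : f 0 = g 0)
    (h : ∀ n, f (n + 1) - f n = g (n + 1) - g n) (n : ℤ) : f n = g n := by
  induction n using Int.induction_on with
  | zero => exact h0
  | succ n ih => linarith [h n]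
  | pred n ih =>
    have := h (-(n : ℤ) - 1)
    rw [sub_add_cancel] at this
    linarith

lemma height_shift (x : ℤ → Bool) (k n : ℤ) :
    height (fun i => x (i + k)) n = height x (n + k) - height x k := by
  refine eq_of_increments_eq (g := fun n => height x (n + k) - height x k)
    (by simp [height_zero]) (fun n => ?_) n
  rw [height_add_one, add_right_comm, height_add_one]
  ring

lemma continuous_height_apply (n : ℤ) : Continuous fun x : ℤ → Bool => height x n := by
  have h : ∀ i : ℤ, Continuous fun x : ℤ → Bool => (x i).toInt :=
    fun i => (continuous_of_discreteTopology (f := Bool.toInt)).comp (continuous_apply i)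
  rcases n with n | n
  · exact continuous_finsetSum _ fun i _ => h i
  · exact (continuous_finsetSum _ fun i _ => h _).neg

lemma continuous_height : Continuous height := continuous_pi continuous_height_apply

/-- The binary sequence of increments of an integer valued function. -/
def increments (H : ℤ → ℤ) : ℤ → Bool := fun n => decide (H n < H (n + 1))

lemma increments_height (x : ℤ → Bool) : increments (height x) = x := by
  funext n
  rw [increments, height_add_one]
  cases x n <;> simp

lemma continuous_increments : Continuous increments :=
  continuous_pi fun n => (continuous_of_discreteTopology (f := fun p : ℤ × ℤ =>
    decide (p.1 < p.2))).comp (f := fun H : ℤ → ℤ => (H n, H (n + 1)))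
      ((continuous_apply n).prodMk (continuous_apply (n + 1)))

/-- The functions `n ↦ ⌊r + n α⌋` and `n ↦ ⌈r + n α⌉ - 1`, `r ∈ ℝ`, described by inequalities. -/
def IsLineHeight (α : ℝ) (H : ℤ → ℤ) : Prop := ∀ i j : ℤ, (H i : ℝ) - i * α ≤ H j - j * α + 1

lemma IsLineHeight.translate {α : ℝ} {H : ℤ → ℤ} (hH : IsLineHeight α H) (m n : ℤ) :
    IsLineHeight α fun i => H (i + n) + m := by
  intro i j
  have := hH (i + n) (j + n)
  push_cast at this ⊢
  linarith

lemma IsLineHeight.height_increments {α : ℝ} (hα : α ∈ Ioo (0 : ℝ) 1) {H : ℤ → ℤ}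
    (hH : IsLineHeight α H) (n : ℤ) : height (increments H) n = H n - H 0 := by
  refine eq_of_increments_eq (g := fun n => H n - H 0) (by simp [height_zero]) (fun n => ?_) n
  have h1 := hH (n + 1) n
  have h2 := hH n (n + 1)
  push_cast at h1 h2
  have h3 : H (n + 1) < H n + 2 := by
    have : (H (n + 1) : ℝ) < H n + 2 := by linarith [hα.2]
    exact_mod_cast this
  have h4 : H n < H (n + 1) + 1 := by
    have : (H n : ℝ) < H (n + 1) + 1 := by linarith [hα.1]
    exact_mod_cast this
  rw [height_add_one]
  by_cases h : H n < H (n + 1)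
  · simp [increments, h]; omega
  · simp [increments, h]; omega

lemma sturmianCode_toInt {α : ℝ} (hα : α ∈ Ioo (0 : ℝ) 1) (t : ℝ) :
    (sturmianCode α t).toInt = ⌊t + α⌋ - ⌊t⌋ := by
  have h1 := Int.floor_add_fract t
  have h2 := Int.fract_nonneg t
  have h3 := Int.fract_lt_one t
  by_cases h : 1 - α ≤ Int.fract t
  · have : ⌊t + α⌋ = ⌊t⌋ + 1 := by
      rw [Int.floor_eq_iff]
      push_cast
      constructor <;> linarith [hα.1, hα.2]
    simp [sturmianCode, h, this]
  · have : ⌊t + α⌋ = ⌊t⌋ := by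
      rw [Int.floor_eq_iff]
      constructor <;> linarith [hα.1, hα.2]
    simp [sturmianCode, h, this]

lemma height_sturmianSeqZ {α : ℝ} (hα : α ∈ Ioo (0 : ℝ) 1) (t : ℝ) (n : ℤ) :
    height (sturmianSeqZ α t) n = ⌊t + n * α⌋ - ⌊t⌋ := by
  refine eq_of_increments_eq (g := fun n : ℤ => ⌊t + n * α⌋ - ⌊t⌋) (by simp [height_zero])
    (fun n => ?_) n
  rw [height_add_one, sturmianSeqZ, sturmianCode_toInt hα]
  push_cast
  rw [add_one_mul, ← add_assoc]
  ring

lemma isLineHeight_floor (α t : ℝ) : IsLineHeight α fun n => ⌊t + n * α⌋ := by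
  intro i j
  linarith [Int.floor_le (t + i * α), Int.lt_floor_add_one (t + j * α)]

lemma isClosed_isLineHeight (α : ℝ) : IsClosed {H : ℤ → ℤ | IsLineHeight α H} := by
  have h : ∀ i : ℤ, Continuous fun H : ℤ → ℤ => (H i : ℝ) :=
    fun i => continuous_of_discreteTopology.comp (continuous_apply i)
  have : {H : ℤ → ℤ | IsLineHeight α H} =
      ⋂ i : ℤ, ⋂ j : ℤ, {H : ℤ → ℤ | (H i : ℝ) - i * α ≤ H j - j * α + 1} := by
    ext H; simp [IsLineHeight]
  rw [this]
  refine isClosed_iInter fun i => isClosed_iInter fun j => isClosed_le ?_ ?_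
  · exact (h i).sub continuous_const
  · exact ((h j).sub continuous_const).add continuous_const

lemma isLineHeight_height {α : ℝ} (hα : α ∈ Ioo (0 : ℝ) 1) {x : ℤ → Bool}
    (hx : x ∈ sturmianZ α) : IsLineHeight α (height x) := by
  refine closure_minimal (t := height ⁻¹' {H | IsLineHeight α H}) ?_
    ((isClosed_isLineHeight α).preimage continuous_height) hx
  rintro _ ⟨t, rfl⟩
  show IsLineHeight α (height (sturmianSeqZ α t))
  have := (isLineHeight_floor α t).translate (-⌊t⌋) 0
  convert this using 2 with n
  rw [height_sturmianSeqZ hα, add_zero]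
  ring

/-- On finite sets, functions of line height type are given by floors of affine functions. -/
lemma IsLineHeight.exists_floor {α : ℝ} (hα : Irrational α) {H : ℤ → ℤ} (hH : IsLineHeight α H)
    (J : Finset ℤ) : ∃ t : ℝ, ∀ i ∈ J, ⌊t + i * α⌋ = H i := by
  rcases J.eq_empty_or_nonempty with rfl | hJ
  · exact ⟨0, by simp⟩
  obtain ⟨j, hj, hmax⟩ := J.exists_max_image (fun i => (H i : ℝ) - i * α) hJ
  refine ⟨H j - j * α, fun i hi => ?_⟩
  rw [Int.floor_eq_iff]
  refine ⟨by linarith [hmax i hi], ?_⟩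
  rcases eq_or_ne i j with rfl | hij
  · linarith
  refine lt_of_le_of_ne (by linarith [hH j i]) fun h => ?_
  refine (hα.intCast_mul (sub_ne_zero.mpr hij)).ne_int (H i + 1 - H j) ?_
  push_cast
  linarith

lemma IsLineHeight.increments_mem {α : ℝ} (hα : Irrational α) (hαm : α ∈ Ioo (0 : ℝ) 1)
    {H : ℤ → ℤ} (hH : IsLineHeight α H) : increments H ∈ sturmianZ α := by
  choose t ht using fun k : ℕ => hH.exists_floor hα (Finset.Icc (-(k : ℤ)) (k + 1))
  refine mem_closure_of_tendsto (f := fun k => sturmianSeqZ α (t k)) (b := Filter.atTop)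
    (tendsto_pi_nhds.mpr fun i => ?_) (Filter.Eventually.of_forall fun k => ⟨t k, rfl⟩)
  refine tendsto_const_nhds.congr' ?_
  filter_upwards [Filter.eventually_ge_atTop i.natAbs] with k hk
  have h1 := ht k i (by rw [Finset.mem_Icc]; omega)
  have h2 := ht k (i + 1) (by rw [Finset.mem_Icc]; omega)
  have h3 := sturmianCode_toInt hαm (t k + i * α)
  have h4 : t k + i * α + α = t k + ((i + 1 : ℤ) : ℝ) * α := by push_cast; ring
  rw [h4, h1, h2] at h3
  show decide (H i < H (i + 1)) = sturmianCode α (t k + i * α)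
  cases h : sturmianCode α (t k + i * α) <;> rw [h] at h3 <;> simp at h3 ⊢ <;> omega

/-! ### Position of a height function -/

lemma exists_int_sub_mul_between {α : ℝ} (hα : Irrational α) {a b : ℝ} (hab : a < b) :
    ∃ m i : ℤ, a < m - i * α ∧ (m : ℝ) - i * α < b := by
  have hd : Dense (AddSubgroup.closure {1, α} : Set ℝ) :=
    dense_addSubgroupClosure_pair_iff.mpr (by simpa using hα.inv)
  obtain ⟨y, hy, hay, hyb⟩ := hd.exists_between hab
  obtain ⟨m, n, rfl⟩ := AddSubgroup.mem_closure_pair.mp hy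
  refine ⟨m, -n, ?_, ?_⟩ <;> simp at hay hyb ⊢ <;> linarith

/-- The number `r` for which `H n` is `⌊r + n α⌋` or `⌈r + n α⌉ - 1`. -/
def position (α : ℝ) (H : ℤ → ℤ) : ℝ := ⨆ i : ℤ, ((H i : ℝ) - i * α)

lemma IsLineHeight.le_position {α : ℝ} {H : ℤ → ℤ} (hH : IsLineHeight α H) (i : ℤ) :
    (H i : ℝ) ≤ position α H + i * α := by
  have := le_ciSup (f := fun i : ℤ => (H i : ℝ) - i * α)
    ⟨H 0 - (0 : ℤ) * α + 1, by rintro _ ⟨j, rfl⟩; exact hH j 0⟩ i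
  change (H i : ℝ) - i * α ≤ position α H at this
  linarith

lemma IsLineHeight.position_le {α : ℝ} {H : ℤ → ℤ} (hH : IsLineHeight α H) (i : ℤ) :
    position α H + i * α ≤ H i + 1 := by
  have : position α H ≤ H i - i * α + 1 := ciSup_le fun j => hH j i
  linarith

lemma position_eq {α : ℝ} (hα : Irrational α) {H : ℤ → ℤ} {r : ℝ}
    (h1 : ∀ i : ℤ, (H i : ℝ) ≤ r + i * α) (h2 : ∀ i : ℤ, r + i * α ≤ H i + 1) :
    position α H = r := by
  have hH : IsLineHeight α H := fun i j => by linarith [h1 i, h2 j]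
  have key : ∀ r s : ℝ, (∀ i : ℤ, (H i : ℝ) ≤ r + i * α) → (∀ i : ℤ, s + i * α ≤ H i + 1) →
      s ≤ r := by
    intro r s hr hs
    by_contra! hrs
    obtain ⟨m, i, h3, h4⟩ := exists_int_sub_mul_between hα hrs
    have h5 : H i < m := by
      have : (H i : ℝ) < m := by linarith [hr i]
      exact_mod_cast this
    have h6 : (H i : ℝ) + 1 ≤ m := by exact_mod_cast h5
    linarith [hs i]
  exact le_antisymm (key _ _ h1 hH.position_le) (key _ _ hH.le_position h2)

lemma IsLineHeight.position_translate {α : ℝ} (hα : Irrational α) {H : ℤ → ℤ}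
    (hH : IsLineHeight α H) (m n : ℤ) :
    position α (fun i => H (i + n) + m) = position α H + m + n * α := by
  refine position_eq hα (fun i => ?_) fun i => ?_
  · have := hH.le_position (i + n)
    push_cast at this ⊢
    linarith
  · have := hH.position_le (i + n)
    push_cast at this ⊢
    linarith

lemma continuousOn_position {α : ℝ} (hα : Irrational α) :
    Continuous fun H : {H : ℤ → ℤ // IsLineHeight α H} => position α H := by
  have hopen : ∀ (H : {H : ℤ → ℤ // IsLineHeight α H}) (i : ℤ), ∀ᶠ K in nhds H, K.1 i = H.1 i := by
    intro H i
    have : Continuous fun K : {H : ℤ → ℤ // IsLineHeight α H} => K.1 i :=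
      (continuous_apply i).comp continuous_subtype_val
    exact this.continuousAt.eventually ((isOpen_discrete {H.1 i}).mem_nhds rfl)
  rw [continuous_iff_continuousAt]
  intro H
  refine tendsto_order.mpr ⟨fun a ha => ?_, fun b hb => ?_⟩
  · obtain ⟨m, i, h1, h2⟩ := exists_int_sub_mul_between hα ha
    filter_upwards [hopen H i] with K hK
    have h3 : m < H.1 i + 1 := by
      have : (m : ℝ) < H.1 i + 1 := by linarith [H.2.position_le i]
      exact_mod_cast this
    have h4 : (m : ℝ) ≤ H.1 i := by exact_mod_cast Int.lt_add_one_iff.mp h3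
    have := K.2.le_position i
    rw [hK] at this
    linarith
  · obtain ⟨m, i, h1, h2⟩ := exists_int_sub_mul_between hα hb
    filter_upwards [hopen H i] with K hK
    have h3 : H.1 i < m := by
      have : (H.1 i : ℝ) < m := by linarith [H.2.le_position i]
      exact_mod_cast this
    have h4 : (H.1 i : ℝ) + 1 ≤ m := by exact_mod_cast h3
    have := K.2.position_le i
    rw [hK] at this
    linarith

/-! ### Points of the suspension -/

lemma translate_mem_sturmianZ {α : ℝ} (n : ℤ) {x : ℤ → Bool} (hx : x ∈ sturmianZ α) :
    (fun i => x (i + n)) ∈ sturmianZ α := by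
  have h : MapsTo (fun (x : ℤ → Bool) i => x (i + n)) {x | ∃ t : ℝ, x = sturmianSeqZ α t}
      {x | ∃ t : ℝ, x = sturmianSeqZ α t} := by
    rintro _ ⟨t, rfl⟩
    refine ⟨t + n * α, funext fun i => ?_⟩
    show sturmianCode α (t + ((i + n : ℤ) : ℝ) * α) = sturmianCode α (t + n * α + i * α)
    congr 1
    push_cast
    ring
  exact h.closure (continuous_pi fun i => continuous_apply (i + n)) hx

/-- The `n`-th power of the shift of the two-sided Sturmian subshift. -/
def shiftPow {α : ℝ} (n : ℤ) (x : ↥(sturmianZ α)) : ↥(sturmianZ α) :=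
  ⟨fun i => x.1 (i + n), translate_mem_sturmianZ n x.2⟩

lemma continuous_shiftPow {α : ℝ} (n : ℤ) : Continuous (shiftPow (α := α) n) :=
  Continuous.subtype_mk (f := fun (x : ↥(sturmianZ α)) i => x.1 (i + n))
    (continuous_pi fun i => (continuous_apply (i + n)).comp continuous_subtype_val) _

lemma shiftPow_zero {α : ℝ} (x : ↥(sturmianZ α)) : shiftPow 0 x = x :=
  Subtype.ext (funext fun i => by simp [shiftPow])

lemma shiftPow_shiftPow {α : ℝ} (m n : ℤ) (x : ↥(sturmianZ α)) :
    shiftPow m (shiftPow n x) = shiftPow (m + n) x :=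
  Subtype.ext (funext fun i => by simp [shiftPow, add_assoc])

lemma sturmianShiftZ_eq {α : ℝ} (x : ↥(sturmianZ α)) : sturmianShiftZ α x = shiftPow 1 x := rfl

/-- The point `[x, s]` of the suspension. -/
def suspMk {α : ℝ} (x : ↥(sturmianZ α)) (s : ℝ) : Suspension α := Quot.mk (suspRel α) (x, s)

lemma continuous_suspMk {α : ℝ} :
    Continuous fun p : ↥(sturmianZ α) × ℝ => suspMk p.1 p.2 :=
  continuous_quot_mk

lemma exists_suspMk_eq {α : ℝ} (u : Suspension α) : ∃ x s, suspMk x s = u := by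
  obtain ⟨⟨x, s⟩, h⟩ := Quot.exists_rep u
  exact ⟨x, s, h⟩

lemma suspMk_shiftPow {α : ℝ} (n : ℤ) (x : ↥(sturmianZ α)) (s : ℝ) :
    suspMk (shiftPow n x) s = suspMk x (s + n) := by
  have step : ∀ (x : ↥(sturmianZ α)) (s : ℝ), suspMk (shiftPow 1 x) s = suspMk x (s + 1) :=
    fun x s => (Quot.sound ⟨x, s, rfl, rfl⟩).symm
  induction n using Int.induction_on generalizing s with
  | zero => simp [shiftPow_zero]
  | succ n ih =>
    rw [add_comm, ← shiftPow_shiftPow, step, ih]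
    congr 1
    push_cast
    ring
  | pred n ih =>
    have := step (shiftPow (-n - 1) x) (s - 1)
    rw [shiftPow_shiftPow, add_sub_cancel, sub_add_cancel] at this
    rw [← this, ih]
    congr 1
    push_cast
    ring

lemma suspMk_eq_iff {α : ℝ} (x y : ↥(sturmianZ α)) (s t : ℝ) :
    suspMk x s = suspMk y t ↔ ∃ n : ℤ, y = shiftPow n x ∧ s = t + n := by
  constructor
  · intro h
    have key : ∀ p q : ↥(sturmianZ α) × ℝ, Relation.EqvGen (suspRel α) p q →
        ∃ n : ℤ, q.1 = shiftPow n p.1 ∧ p.2 = q.2 + n := by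
      intro p q h
      induction h with
      | rel p q h =>
        obtain ⟨x, s, rfl, rfl⟩ := h
        exact ⟨1, rfl, by simp⟩
      | refl p => exact ⟨0, (shiftPow_zero _).symm, by simp⟩
      | symm p q _ ih =>
        obtain ⟨n, h1, h2⟩ := ih
        refine ⟨-n, ?_, ?_⟩
        · rw [h1, shiftPow_shiftPow, neg_add_cancel, shiftPow_zero]
        · rw [h2]; push_cast; ring
      | trans p q r _ _ ih1 ih2 =>
        obtain ⟨n, h1, h2⟩ := ih1
        obtain ⟨m, h3, h4⟩ := ih2
        refine ⟨m + n, ?_, ?_⟩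
        · rw [h3, h1, shiftPow_shiftPow]
        · rw [h2, h4]; push_cast; ring
    exact key _ _ (Quot.eqvGen_exact h)
  · rintro ⟨n, rfl, rfl⟩
    rw [suspMk_shiftPow]

/-! ### Equivalent irrationals have homeomorphic suspensions -/

/-- `β = (a α + b) / (c α + d)` with positive denominator and determinant `ε = ±1`. -/
structure UnimodularRel (α β : ℝ) (a b c d ε : ℤ) : Prop where
  sq_eq_one : ε * ε = 1
  det_eq : a * d - b * c = ε
  pos : 0 < c * α + d
  eq : β * (c * α + d) = a * α + b

section Transform

variable {α β : ℝ} {a b c d ε : ℤ}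

lemma UnimodularRel.inv_denom (h : UnimodularRel α β a b c d ε) :
    (((-(ε * c) : ℤ) : ℝ) * β + ((ε * a : ℤ) : ℝ)) * (c * α + d) = 1 := by
  have h1 : ((a * d - b * c : ℤ) : ℝ) = ε := by rw [h.det_eq]
  have h2 : ((ε * ε : ℤ) : ℝ) = 1 := by rw [h.sq_eq_one]; simp
  push_cast at h1 h2 ⊢
  linear_combination (-ε * c) * h.eq + ε * h1 + h2

lemma UnimodularRel.symm (h : UnimodularRel α β a b c d ε) :
    UnimodularRel β α (ε * d) (-(ε * b)) (-(ε * c)) (ε * a) ε where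
  sq_eq_one := h.sq_eq_one
  det_eq := by linear_combination (ε * ε) * h.det_eq + ε * h.sq_eq_one
  pos := pos_of_mul_pos_left (by rw [h.inv_denom]; exact one_pos) h.pos.le
  eq := by
    push_cast
    linear_combination (-ε) * h.eq

/-- The function `H'` with `m ≤ H' n` if and only if `m d - n b ≤ H (n a - m c)`. -/
def heightTransform (a b c d : ℤ) (H : ℤ → ℤ) (n : ℤ) : ℤ :=
  sSup {m | m * d - n * b ≤ H (n * a - m * c)}

lemma UnimodularRel.le_heightTransform_iff (h : UnimodularRel α β a b c d ε) {H : ℤ → ℤ}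
    (hH : IsLineHeight α H) (m n : ℤ) :
    m ≤ heightTransform a b c d H n ↔ m * d - n * b ≤ H (n * a - m * c) := by
  have hκ := h.pos
  have hid : ∀ m n : ℤ, ((m * d - n * b : ℤ) : ℝ) - ((n * a - m * c : ℤ) : ℝ) * α =
      (c * α + d) * (m - n * β) := by
    intro m n
    push_cast
    linear_combination (n : ℝ) * h.eq
  have hanti : ∀ m m' : ℤ, m' < m → m * d - n * b ≤ H (n * a - m * c) →
      m' * d - n * b ≤ H (n * a - m' * c) := by
    intro m m' hlt hm
    have h1 := hH (n * a - m * c) (n * a - m' * c)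
    have h2 : ((m * d - n * b : ℤ) : ℝ) ≤ H (n * a - m * c) := by exact_mod_cast hm
    have h3 := hid m n
    have h4 := hid m' n
    have h5 : (m' : ℝ) < m := by exact_mod_cast hlt
    have h6 := mul_lt_mul_of_pos_left h5 hκ
    have h7 : ((m' * d - n * b : ℤ) : ℝ) < H (n * a - m' * c) + 1 := by nlinarith
    exact Int.lt_add_one_iff.mp (by exact_mod_cast h7)
  have hbdd : BddAbove {m | m * d - n * b ≤ H (n * a - m * c)} := by
    refine ⟨⌈((H 0 : ℝ) + 1) / (c * α + d) + n * β⌉, fun m hm => ?_⟩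
    have h1 := hH (n * a - m * c) 0
    have h2 : ((m * d - n * b : ℤ) : ℝ) ≤ H (n * a - m * c) := by exact_mod_cast hm
    have h3 := hid m n
    have h4 : (m : ℝ) - n * β ≤ ((H 0 : ℝ) + 1) / (c * α + d) := by
      rw [le_div_iff₀ hκ]
      push_cast at h1 h2 h3
      linarith
    have h5 := Int.le_ceil (((H 0 : ℝ) + 1) / (c * α + d) + n * β)
    have h6 : (m : ℝ) ≤ ⌈((H 0 : ℝ) + 1) / (c * α + d) + n * β⌉ := by linarith
    exact_mod_cast h6
  have hne : {m | m * d - n * b ≤ H (n * a - m * c)}.Nonempty := by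
    refine ⟨⌊((H 0 : ℝ) - 1) / (c * α + d) + n * β⌋, ?_⟩
    set m := ⌊((H 0 : ℝ) - 1) / (c * α + d) + n * β⌋
    have h1 := hH 0 (n * a - m * c)
    have h3 := hid m n
    have h5 : (m : ℝ) ≤ _ := Int.floor_le (((H 0 : ℝ) - 1) / (c * α + d) + n * β)
    have h4 : (m : ℝ) - n * β ≤ ((H 0 : ℝ) - 1) / (c * α + d) := by linarith
    rw [le_div_iff₀ hκ] at h4
    have h2 : ((m * d - n * b : ℤ) : ℝ) ≤ H (n * a - m * c) := by
      push_cast at h1 h3 ⊢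
      linarith
    exact_mod_cast h2
  constructor
  · intro hm
    rcases hm.lt_or_eq with hm | hm
    · exact hanti _ _ hm (Int.csSup_mem hne hbdd)
    · rw [hm]
      exact Int.csSup_mem hne hbdd
  · exact fun hm => le_csSup hbdd hm

lemma UnimodularRel.heightTransform_eq (h : UnimodularRel α β a b c d ε) {H K : ℤ → ℤ}
    (hH : IsLineHeight α H)
    (hK : ∀ m n : ℤ, m ≤ K n ↔ m * d - n * b ≤ H (n * a - m * c)) :
    heightTransform a b c d H = K :=
  funext fun n => eq_of_forall_le_iff fun m => by rw [h.le_heightTransform_iff hH, hK]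

lemma UnimodularRel.isLineHeight (h : UnimodularRel α β a b c d ε) {H : ℤ → ℤ}
    (hH : IsLineHeight α H) : IsLineHeight β (heightTransform a b c d H) := by
  intro i j
  have h1 := (h.le_heightTransform_iff hH _ i).mp le_rfl
  have h2 := (h.le_heightTransform_iff hH (heightTransform a b c d H j + 1) j).not.mp (by omega)
  set m := heightTransform a b c d H i
  set k := heightTransform a b c d H j
  have h3 := hH (i * a - m * c) (j * a - (k + 1) * c)
  rw [not_le, ← Int.add_one_le_iff] at h2
  have h4 : ((m * d - i * b : ℤ) : ℝ) ≤ H (i * a - m * c) := by exact_mod_cast h1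
  have h5 : (H (j * a - (k + 1) * c) : ℝ) + 1 ≤ ((k + 1) * d - j * b : ℤ) := by exact_mod_cast h2
  push_cast at h3 h4 h5
  have h6 : (c * α + d) * (m - i * β) ≤ (c * α + d) * (k - j * β + 1) := by
    linear_combination h3 + h4 + h5 + ((j : ℝ) - i) * h.eq
  exact le_of_mul_le_mul_left h6 h.pos

lemma UnimodularRel.position_heightTransform (h : UnimodularRel α β a b c d ε) (hβ : Irrational β)
    {H : ℤ → ℤ} (hH : IsLineHeight α H) :
    position β (heightTransform a b c d H) = position α H / (c * α + d) := by
  have hκ := h.pos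
  refine position_eq hβ (fun n => ?_) fun n => ?_
  · have h1 := (h.le_heightTransform_iff hH _ n).mp le_rfl
    set m := heightTransform a b c d H n
    have h2 := hH.le_position (n * a - m * c)
    have h4 : ((m * d - n * b : ℤ) : ℝ) ≤ H (n * a - m * c) := by exact_mod_cast h1
    rw [← sub_le_iff_le_add, le_div_iff₀ hκ]
    push_cast at h2 h4
    linear_combination h2 + h4 - (n : ℝ) * h.eq
  · have h1 := (h.le_heightTransform_iff hH (heightTransform a b c d H n + 1) n).not.mp (by omega)
    set m := heightTransform a b c d H n
    have h2 := hH.position_le (n * a - (m + 1) * c)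
    rw [not_le, ← Int.add_one_le_iff] at h1
    have h4 : (H (n * a - (m + 1) * c) : ℝ) + 1 ≤ ((m + 1) * d - n * b : ℤ) := by
      exact_mod_cast h1
    rw [← le_sub_iff_add_le, div_le_iff₀ hκ]
    push_cast at h2 h4
    linear_combination h2 + h4 + (n : ℝ) * h.eq

lemma UnimodularRel.heightTransform_heightTransform (h : UnimodularRel α β a b c d ε)
    {H : ℤ → ℤ} (hH : IsLineHeight α H) :
    heightTransform (ε * d) (-(ε * b)) (-(ε * c)) (ε * a) (heightTransform a b c d H) = H := by
  refine h.symm.heightTransform_eq (h.isLineHeight hH) fun m n => ?_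
  rw [h.le_heightTransform_iff hH]
  have hd := h.det_eq
  have hs := h.sq_eq_one
  have e1 : (m * (ε * a) - n * -(ε * b)) * d - (n * (ε * d) - m * -(ε * c)) * b = m := by
    linear_combination m * ε * hd + m * hs
  have e2 : (n * (ε * d) - m * -(ε * c)) * a - (m * (ε * a) - n * -(ε * b)) * c = n := by
    linear_combination n * ε * hd + n * hs
  rw [e1, e2]

lemma UnimodularRel.heightTransform_translate (h : UnimodularRel α β a b c d ε) {H : ℤ → ℤ}
    (hH : IsLineHeight α H) (k l : ℤ) :
    heightTransform a b c d (fun i => H (i + (c * k + a * l)) + (d * k + b * l)) =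
      fun i => heightTransform a b c d H (i + l) + k := by
  refine h.heightTransform_eq (hH.translate _ _) fun m n => ?_
  rw [← sub_le_iff_le_add, h.le_heightTransform_iff hH, ← sub_le_iff_le_add]
  have e1 : (m - k) * d - (n + l) * b = m * d - n * b - (d * k + b * l) := by ring
  have e2 : (n + l) * a - (m - k) * c = n * a - m * c + (c * k + a * l) := by ring
  rw [e1, e2]

lemma UnimodularRel.continuous_heightTransform (h : UnimodularRel α β a b c d ε) :
    Continuous fun H : {H : ℤ → ℤ // IsLineHeight α H} => heightTransform a b c d H.1 := by
  have hmem : ∀ (m n : ℤ) (H : {H : ℤ → ℤ // IsLineHeight α H}), ∀ᶠ K in nhds H,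
      (m ≤ heightTransform a b c d K.1 n ↔ m ≤ heightTransform a b c d H.1 n) := by
    intro m n H
    have : Continuous fun K : {H : ℤ → ℤ // IsLineHeight α H} => K.1 (n * a - m * c) :=
      (continuous_apply _).comp continuous_subtype_val
    filter_upwards [this.continuousAt.eventually ((isOpen_discrete {_}).mem_nhds rfl)] with K hK
    rw [h.le_heightTransform_iff K.2, h.le_heightTransform_iff H.2, hK]
  refine continuous_pi fun n => continuous_iff_continuousAt.mpr fun H => ?_
  refine tendsto_const_nhds.congr' ?_
  filter_upwards [hmem (heightTransform a b c d H.1 n) n H,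
    hmem (heightTransform a b c d H.1 n + 1) n H] with K h1 h2
  omega

end Transform

/-- The point `[x, s]` of the suspension where `x` is the sequence of increments of `H`. -/
def suspOfHeight {α : ℝ} (hα : Irrational α) (hαm : α ∈ Ioo (0 : ℝ) 1) {H : ℤ → ℤ}
    (hH : IsLineHeight α H) (s : ℝ) : Suspension α :=
  suspMk ⟨increments H, hH.increments_mem hα hαm⟩ s

section SuspOfHeight

variable {α : ℝ} (hα : Irrational α) (hαm : α ∈ Ioo (0 : ℝ) 1)

lemma suspOfHeight_congr {H K : ℤ → ℤ} (hH : IsLineHeight α H) (hK : IsLineHeight α K)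
    (h : H = K) {s t : ℝ} (hst : s = t) :
    suspOfHeight hα hαm hH s = suspOfHeight hα hαm hK t := by
  subst h hst
  rfl

lemma suspOfHeight_height (x : ↥(sturmianZ α)) (s : ℝ) :
    suspOfHeight hα hαm (isLineHeight_height hαm x.2) s = suspMk x s := by
  rw [suspOfHeight]
  congr
  exact increments_height x.1

lemma suspOfHeight_translate {H : ℤ → ℤ} (hH : IsLineHeight α H) (m n : ℤ) (s : ℝ) :
    suspOfHeight hα hαm (hH.translate m n) (s - n) = suspOfHeight hα hαm hH s := by
  rw [suspOfHeight, suspOfHeight, eq_comm, suspMk_eq_iff]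
  refine ⟨n, Subtype.ext (funext fun i => ?_), by ring⟩
  simp only [increments, shiftPow, add_lt_add_iff_right]
  rw [add_right_comm]

lemma continuous_suspOfHeight :
    Continuous fun p : {H : ℤ → ℤ // IsLineHeight α H} × ℝ =>
      suspOfHeight hα hαm p.1.2 p.2 :=
  continuous_suspMk.comp (((continuous_increments.comp
    (continuous_subtype_val.comp continuous_fst)).subtype_mk _).prodMk continuous_snd)

end SuspOfHeight

section Map

variable {α β : ℝ} {a b c d ε : ℤ} (hα : Irrational α) (hαm : α ∈ Ioo (0 : ℝ) 1)
  (hβ : Irrational β) (hβm : β ∈ Ioo (0 : ℝ) 1)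

/-- The new flow coordinate under a unimodular change of coordinates. -/
def timeTransform (α : ℝ) (c d ε : ℤ) (H : ℤ → ℤ) (s : ℝ) : ℝ :=
  ε * (c * position α H + (c * α + d) * s)

/-- The unimodular change of coordinates on heights, followed by the projection to the
suspension. -/
def UnimodularRel.mapHeight (h : UnimodularRel α β a b c d ε) {H : ℤ → ℤ}
    (hH : IsLineHeight α H) (s : ℝ) : Suspension β :=
  suspOfHeight hβ hβm (h.isLineHeight hH) (timeTransform α c d ε H s)

include hα in
lemma UnimodularRel.mapHeight_translate (h : UnimodularRel α β a b c d ε) {H : ℤ → ℤ}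
    (hH : IsLineHeight α H) (m n : ℤ) (s : ℝ) :
    h.mapHeight hβ hβm (hH.translate m n) (s - n) = h.mapHeight hβ hβm hH s := by
  have hd := h.det_eq
  have hs := h.sq_eq_one
  have e1 : c * (ε * (a * m - b * n)) + a * (ε * (d * n - c * m)) = n := by
    linear_combination n * ε * hd + n * hs
  have e2 : d * (ε * (a * m - b * n)) + b * (ε * (d * n - c * m)) = m := by
    linear_combination m * ε * hd + m * hs
  have key := h.heightTransform_translate hH (ε * (a * m - b * n)) (ε * (d * n - c * m))
  rw [e1, e2] at key
  rw [UnimodularRel.mapHeight, UnimodularRel.mapHeight,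
    ← suspOfHeight_translate hβ hβm (h.isLineHeight hH) (ε * (a * m - b * n))
      (ε * (d * n - c * m))]
  refine suspOfHeight_congr _ _ _ _ key ?_
  rw [timeTransform, timeTransform, hH.position_translate hα]
  push_cast
  ring

/-- The map between suspensions induced by a unimodular change of coordinates. -/
def UnimodularRel.map (h : UnimodularRel α β a b c d ε) : Suspension α → Suspension β :=
  Quot.lift (fun p => h.mapHeight hβ hβm (isLineHeight_height hαm p.1.2) p.2) (by
    rintro _ _ ⟨x, s, rfl, rfl⟩
    dsimp only
    rw [← h.mapHeight_translate hα hβ hβm (isLineHeight_height hαm x.2) (-height x.1 1) 1 (s + 1)]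
    have e : height (sturmianShiftZ α x).1 = fun i => height x.1 (i + 1) + -height x.1 1 :=
      funext fun i => height_shift x.1 1 i
    simp only [e, Int.cast_one, add_sub_cancel_right])

lemma UnimodularRel.map_suspOfHeight (h : UnimodularRel α β a b c d ε) {H : ℤ → ℤ}
    (hH : IsLineHeight α H) (s : ℝ) :
    h.map hα hαm hβ hβm (suspOfHeight hα hαm hH s) = h.mapHeight hβ hβm hH s := by
  rw [← h.mapHeight_translate hα hβ hβm hH (-H 0) 0 s]
  show h.mapHeight hβ hβm
    (isLineHeight_height hαm (hH.increments_mem hα hαm)) s = _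
  have e : height (increments H) = fun i => H (i + 0) + -H 0 := funext fun i => by
    rw [hH.height_increments hαm, add_zero]
    rfl
  simp only [e, Int.cast_zero, sub_zero]

lemma UnimodularRel.map_map (h : UnimodularRel α β a b c d ε) (u : Suspension α) :
    h.symm.map hβ hβm hα hαm (h.map hα hαm hβ hβm u) = u := by
  obtain ⟨x, s, rfl⟩ := exists_suspMk_eq u
  rw [← suspOfHeight_height hα hαm, h.map_suspOfHeight, UnimodularRel.mapHeight,
    h.symm.map_suspOfHeight, UnimodularRel.mapHeight]
  refine suspOfHeight_congr _ _ _ _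
    (h.heightTransform_heightTransform (isLineHeight_height hαm x.2)) ?_
  rw [timeTransform, eq_inv_of_mul_eq_one_left h.inv_denom,
    h.position_heightTransform hβ (isLineHeight_height hαm x.2),
    timeTransform]
  have h2 : ((ε * ε : ℤ) : ℝ) = 1 := by rw [h.sq_eq_one]; simp
  have hκ := h.pos.ne'
  push_cast at h2 ⊢
  field_simp
  linear_combination s * (c * α + d) * h2

lemma UnimodularRel.map_congr {a' b' c' d' : ℤ} (h : UnimodularRel α β a b c d ε)
    (h' : UnimodularRel α β a' b' c' d' ε) (ha : a = a') (hb : b = b') (hc : c = c')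
    (hd : d = d') : h.map hα hαm hβ hβm = h'.map hα hαm hβ hβm := by
  subst ha hb hc hd
  rfl

lemma UnimodularRel.continuous_map (h : UnimodularRel α β a b c d ε) :
    Continuous (h.map hα hαm hβ hβm) := by
  refine continuous_quot_lift _ ?_
  have h1 : Continuous fun p : ↥(sturmianZ α) × ℝ =>
      (⟨height p.1.1, isLineHeight_height hαm p.1.2⟩ : {H : ℤ → ℤ // IsLineHeight α H}) :=
    (continuous_height.comp (continuous_subtype_val.comp continuous_fst)).subtype_mk _
  have h2 : Continuous fun p : ↥(sturmianZ α) × ℝ => timeTransform α c d ε (height p.1.1) p.2 :=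
    continuous_const.mul ((continuous_const.mul ((continuousOn_position hα).comp h1)).add
      (continuous_const.mul continuous_snd))
  exact (continuous_suspOfHeight hβ hβm).comp
    (f := fun p : ↥(sturmianZ α) × ℝ =>
      ((⟨heightTransform a b c d (height p.1.1), h.isLineHeight (isLineHeight_height hαm p.1.2)⟩ :
        {H : ℤ → ℤ // IsLineHeight β H}), timeTransform α c d ε (height p.1.1) p.2))
    (((h.continuous_heightTransform.comp h1).subtype_mk _).prodMk h2)

/-- A unimodular change of coordinates induces a homeomorphism of suspensions. -/
def UnimodularRel.homeomorph (h : UnimodularRel α β a b c d ε) :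
    Suspension α ≃ₜ Suspension β where
  toFun := h.map hα hαm hβ hβm
  invFun := h.symm.map hβ hβm hα hαm
  left_inv := h.map_map hα hαm hβ hβm
  right_inv u := by
    have hsq := h.sq_eq_one
    rw [h.map_congr hα hαm hβ hβm h.symm.symm (by linear_combination -a * hsq)
      (by linear_combination -b * hsq) (by linear_combination -c * hsq)
      (by linear_combination -d * hsq), h.symm.map_map]
  continuous_toFun := h.continuous_map hα hαm hβ hβm
  continuous_invFun := h.symm.continuous_map hβ hβm hα hαm

end Map

lemma nonempty_homeomorph_of_irrationalEquiv {α β : ℝ} (hα : Irrational α) (hβ : Irrational β)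
    (hαm : α ∈ Ioo (0 : ℝ) 1) (hβm : β ∈ Ioo (0 : ℝ) 1) (h : IrrationalEquiv α β) :
    Nonempty (Suspension α ≃ₜ Suspension β) := by
  obtain ⟨a, b, c, d, hdet, hab⟩ := h
  have hne : (c : ℝ) * α + d ≠ 0 := fun h0 => hβ.ne_zero (by rw [hab, h0, div_zero])
  have hsq : (a * d - b * c) * (a * d - b * c) = 1 := by rcases hdet with h | h <;> rw [h] <;> rfl
  rw [eq_div_iff hne] at hab
  rcases hne.lt_or_gt with hlt | hgt
  · have hrel : UnimodularRel α β (-a) (-b) (-c) (-d) (a * d - b * c) :=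
      ⟨hsq, by ring, by push_cast; linarith, by push_cast; linarith⟩
    exact ⟨hrel.homeomorph hα hαm hβ hβm⟩
  · exact ⟨(UnimodularRel.mk hsq rfl hgt hab).homeomorph hα hαm hβ hβm⟩

/-! ### Integer-valued continuous functions on a Sturmian subshift -/

/-- A function that depends only on the truth values of finitely many predicates forming a chain
is an integral combination of constants and of the indicators of these predicates. -/
lemma mem_of_forall_chain {ι X : Type*} (S : AddSubgroup (X → ℤ)) (v : ι → ℝ) (f : ι → Set X)
    (hf : ∀ i j, v i ≤ v j → f j ⊆ f i) (hconst : ∀ c : ℤ, (fun _ => c) ∈ S)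
    (hind : ∀ i, (f i).indicator (fun _ => 1) ∈ S) (W : Finset ι) (N : X → ℤ)
    (hN : ∀ x y, (∀ i ∈ W, x ∈ f i ↔ y ∈ f i) → N x = N y) : N ∈ S := by
  classical
  induction W using Finset.induction_on_max_value v generalizing N with
  | empty =>
    rcases isEmpty_or_nonempty X with h | ⟨⟨x⟩⟩
    · rw [Subsingleton.elim N 0]
      exact S.zero_mem
    · have : N = fun _ => N x := funext fun y => hN y x (by simp)
      rw [this]
      exact hconst _
  | insert i s _ hmax ih =>
    have hsub : ∀ j ∈ s, f i ⊆ f j := fun j hj => hf j i (hmax j hj)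
    obtain ⟨c, hc⟩ : ∃ c, ∀ x ∈ f i, N x = c := by
      rcases (f i).eq_empty_or_nonempty with h | ⟨y, hy⟩
      · exact ⟨0, by simp [h]⟩
      · refine ⟨N y, fun x hx => hN x y fun j hj => ?_⟩
        rcases Finset.mem_insert.mp hj with rfl | hj
        · exact iff_of_true hx hy
        · exact iff_of_true (hsub j hj hx) (hsub j hj hy)
    obtain ⟨e, he⟩ : ∃ e, ∀ x, x ∉ f i → (∀ j ∈ s, x ∈ f j) → N x = e := by
      by_cases h : ∃ y, y ∉ f i ∧ ∀ j ∈ s, y ∈ f j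
      · obtain ⟨y, hy, hys⟩ := h
        refine ⟨N y, fun x hx hxs => hN x y fun j hj => ?_⟩
        rcases Finset.mem_insert.mp hj with rfl | hj
        · exact iff_of_false hx hy
        · exact iff_of_true (hxs j hj) (hys j hj)
      · exact ⟨0, fun x hx hxs => (h ⟨x, hx, hxs⟩).elim⟩
    have key : (fun x => if x ∈ f i then e else N x) ∈ S := by
      refine ih _ fun x y hxy => ?_
      by_cases hx : x ∈ f i <;> by_cases hy : y ∈ f i
      · simp [hx, hy]
      · simp only [hx, hy, if_true, if_false]
        exact (he y hy fun j hj => (hxy j hj).mp (hsub j hj hx)).symm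
      · simp only [hx, hy, if_true, if_false]
        exact he x hx fun j hj => (hxy j hj).mpr (hsub j hj hy)
      · simp only [hx, hy, if_false]
        refine hN x y fun j hj => ?_
        rcases Finset.mem_insert.mp hj with rfl | hj
        · exact iff_of_false hx hy
        · exact hxy j hj
    have : N = (fun x => if x ∈ f i then e else N x) +
        (c - e) • (f i).indicator (fun _ => 1) := by
      funext x
      by_cases hx : x ∈ f i <;> simp [hx, hc]
    rw [this]
    exact S.add_mem key (S.zsmul_mem (hind i) _)

/-- The integer-valued functions on the Sturmian subshift that differ from a constant
in `ℤ + αℤ` by a bounded coboundary. -/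
def almostConst (α : ℝ) : AddSubgroup (↥(sturmianZ α) → ℤ) where
  carrier := {N | ∃ ρ ∈ ZplusAZ α, ∃ (B : ↥(sturmianZ α) → ℝ) (C : ℝ), (∀ x, |B x| ≤ C) ∧
    ∀ x, (N x : ℝ) = ρ + B (shiftPow 1 x) - B x}
  add_mem' := by
    rintro N N' ⟨ρ, hρ, B, C, hB, h⟩ ⟨ρ', hρ', B', C', hB', h'⟩
    refine ⟨ρ + ρ', add_mem hρ hρ', fun x => B x + B' x, C + C',
      fun x => (abs_add_le _ _).trans (add_le_add (hB x) (hB' x)), fun x => ?_⟩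
    rw [Pi.add_apply, Int.cast_add, h, h']
    ring
  zero_mem' := ⟨0, zero_mem _, fun _ => 0, 0, by simp, by simp⟩
  neg_mem' := by
    rintro N ⟨ρ, hρ, B, C, hB, h⟩
    refine ⟨-ρ, neg_mem hρ, fun x => -B x, C, fun x => by simpa using hB x, fun x => ?_⟩
    rw [Pi.neg_apply, Int.cast_neg, h]
    ring

lemma const_mem_almostConst (α : ℝ) (c : ℤ) : (fun _ => c) ∈ almostConst α :=
  ⟨c, ⟨c, 0, by simp⟩, fun _ => 0, 0, by simp, by simp⟩

lemma almostConst_comp_shiftPow {α : ℝ} {N : ↥(sturmianZ α) → ℤ} (hN : N ∈ almostConst α)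
    (n : ℤ) : (fun x => N (shiftPow n x)) ∈ almostConst α := by
  obtain ⟨ρ, hρ, B, C, hB, h⟩ := hN
  refine ⟨ρ, hρ, fun x => B (shiftPow n x), C, fun x => hB _, fun x => ?_⟩
  show (N (shiftPow n x) : ℝ) = ρ + B (shiftPow n (shiftPow 1 x)) - B (shiftPow n x)
  rw [h, shiftPow_shiftPow, shiftPow_shiftPow, add_comm 1 n]

lemma position_height_shiftPow {α : ℝ} (hα : Irrational α) (hαm : α ∈ Set.Ioo (0 : ℝ) 1)
    (n : ℤ) (x : ↥(sturmianZ α)) :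
    position α (height (shiftPow n x).1) = position α (height x.1) + n * α - height x.1 n := by
  have h := (isLineHeight_height hαm x.2).position_translate hα (-height x.1 n) n
  have h2 : height (shiftPow n x).1 = fun i => height x.1 (i + n) + -height x.1 n :=
    funext fun i => height_shift x.1 n i
  rw [h2, h]
  push_cast
  ring

lemma abs_position_height_le {α : ℝ} (hαm : α ∈ Set.Ioo (0 : ℝ) 1)
    (x : ↥(sturmianZ α)) : |position α (height x.1)| ≤ 1 := by
  have h := isLineHeight_height hαm x.2
  have h1 := h.le_position 0
  have h2 := h.position_le 0
  simp [height_zero] at h1 h2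
  rw [abs_le]
  constructor <;> linarith

lemma height_mem_almostConst {α : ℝ} (hα : Irrational α) (hαm : α ∈ Set.Ioo (0 : ℝ) 1) (j : ℤ) :
    (fun x : ↥(sturmianZ α) => height x.1 j) ∈ almostConst α := by
  have hone : (fun x : ↥(sturmianZ α) => height x.1 1) ∈ almostConst α := by
    refine ⟨α, ⟨0, 1, by simp⟩, fun x => -position α (height x.1), 1,
      fun x => by simpa using abs_position_height_le hαm x, fun x => ?_⟩
    show (height x.1 1 : ℝ) = α + -position α (height (shiftPow 1 x).1) - -position α (height x.1)
    rw [position_height_shiftPow hα hαm]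
    push_cast
    ring
  have hstep : ∀ (x : ↥(sturmianZ α)) (j : ℤ),
      height x.1 (j + 1) = height x.1 j + height (shiftPow j x).1 1 := by
    intro x j
    have : height (shiftPow j x).1 1 = _ := height_shift x.1 j 1
    rw [this, add_comm 1 j]
    ring
  induction j using Int.induction_on with
  | zero => simpa [height_zero] using const_mem_almostConst α 0
  | succ j ih =>
    simp_rw [hstep]
    exact add_mem ih (almostConst_comp_shiftPow hone j)
  | pred j ih =>
    have h : ∀ x : ↥(sturmianZ α), height x.1 (-j - 1) =
        height x.1 (-j) - height (shiftPow (-j - 1) x).1 1 := by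
      intro x
      have := hstep x (-j - 1)
      rw [sub_add_cancel] at this
      rw [this]
      ring
    simp_rw [h]
    exact sub_mem ih (almostConst_comp_shiftPow hone (-j - 1))

lemma height_mem_floor {α : ℝ} (hα : Irrational α) (hαm : α ∈ Set.Ioo (0 : ℝ) 1)
    (x : ↥(sturmianZ α)) (j : ℤ) :
    height x.1 j = ⌊j * α⌋ ∨ height x.1 j = ⌊j * α⌋ + 1 := by
  rcases eq_or_ne j 0 with rfl | hj
  · left
    simp [height_zero]
  have h := isLineHeight_height hαm x.2
  have h1 := h 0 j
  have h2 := h j 0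
  simp only [height_zero, Int.cast_zero, zero_mul, sub_zero, zero_add] at h1 h2
  have hirr : Irrational ((j : ℝ) * α) := hα.intCast_mul hj
  have hne1 : ((height x.1 j + 1 : ℤ) : ℝ) ≠ j * α := (hirr.ne_int _).symm
  have hne2 : ((height x.1 j - 1 : ℤ) : ℝ) ≠ j * α := (hirr.ne_int _).symm
  push_cast at hne1 hne2
  have h3 := Int.floor_le ((j : ℝ) * α)
  have h4 := Int.lt_floor_add_one ((j : ℝ) * α)
  have h5 : (height x.1 j : ℝ) - 1 < j * α := lt_of_le_of_ne (by linarith) hne2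
  have h6 : (j : ℝ) * α < height x.1 j + 1 := lt_of_le_of_ne (by linarith) hne1.symm
  have h7 : height x.1 j < ⌊j * α⌋ + 2 := by
    have : (height x.1 j : ℝ) < ⌊j * α⌋ + 2 := by linarith
    exact_mod_cast this
  have h8 : ⌊j * α⌋ < height x.1 j + 1 := by
    have : (⌊j * α⌋ : ℝ) < height x.1 j + 1 := by linarith
    exact_mod_cast this
  omega

lemma indicator_mem_almostConst {α : ℝ} (hα : Irrational α) (hαm : α ∈ Set.Ioo (0 : ℝ) 1)
    (m j : ℤ) :
    {x : ↥(sturmianZ α) | m ≤ height x.1 j}.indicator (fun _ => (1 : ℤ)) ∈ almostConst α := by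
  have hfl := height_mem_floor hα hαm (j := j)
  rcases lt_trichotomy m (⌊j * α⌋ + 1) with hm | hm | hm
  · convert const_mem_almostConst α 1 using 1
    funext x
    have h : x ∈ {x : ↥(sturmianZ α) | m ≤ height x.1 j} := by
      show m ≤ height x.1 j
      rcases hfl x with h | h <;> omega
    rw [indicator_of_mem h]
  · convert sub_mem (height_mem_almostConst hα hαm j) (const_mem_almostConst α ⌊j * α⌋) using 1
    funext x
    rw [Pi.sub_apply]
    rcases hfl x with h | h
    · have hx : x ∉ {x : ↥(sturmianZ α) | m ≤ height x.1 j} := by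
        show ¬ m ≤ height x.1 j
        omega
      rw [indicator_of_notMem hx, h, sub_self]
    · have hx : x ∈ {x : ↥(sturmianZ α) | m ≤ height x.1 j} := by
        show m ≤ height x.1 j
        omega
      rw [indicator_of_mem hx, h, add_sub_cancel_left]
  · convert const_mem_almostConst α 0 using 1
    funext x
    have h : x ∉ {x : ↥(sturmianZ α) | m ≤ height x.1 j} := by
      show ¬ m ≤ height x.1 j
      rcases hfl x with h | h <;> omega
    rw [indicator_of_notMem h]

instance (α : ℝ) : CompactSpace ↥(sturmianZ α) :=
  isCompact_iff_compactSpace.mp isClosed_closure.isCompact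

lemma exists_window {α : ℝ} {N : ↥(sturmianZ α) → ℤ} (hN : Continuous N) :
    ∃ F : Finset ℤ, ∀ x y : ↥(sturmianZ α), (∀ i ∈ F, x.1 i = y.1 i) → N x = N y := by
  have hloc : ∀ x : ↥(sturmianZ α), ∃ F : Finset ℤ,
      ∀ y : ↥(sturmianZ α), (∀ i ∈ F, x.1 i = y.1 i) → N y = N x := by
    intro x
    have ho : IsOpen (N ⁻¹' {N x}) := (isOpen_discrete _).preimage hN
    obtain ⟨V, hV, hVeq⟩ := isOpen_induced_iff.mp ho
    have hx : x.1 ∈ V := by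
      have : x ∈ Subtype.val ⁻¹' V := by rw [hVeq]; rfl
      exact this
    obtain ⟨F, u, hu, hsub⟩ := isOpen_pi_iff.mp hV x.1 hx
    refine ⟨F, fun y hy => ?_⟩
    have : y ∈ Subtype.val ⁻¹' V := hsub fun i hi => by
      have := (hu i hi).2
      rwa [hy i hi] at this
    rw [hVeq] at this
    exact this
  choose F hF using hloc
  have hopen : ∀ x : ↥(sturmianZ α), IsOpen {y : ↥(sturmianZ α) | ∀ i ∈ F x, x.1 i = y.1 i} := by
    intro x
    have : {y : ↥(sturmianZ α) | ∀ i ∈ F x, x.1 i = y.1 i} =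
        ⋂ i ∈ F x, (fun y : ↥(sturmianZ α) => y.1 i) ⁻¹' {x.1 i} := by
      ext y
      simp [eq_comm]
    rw [this]
    exact isOpen_biInter_finset fun i _ => (isOpen_discrete _).preimage
      ((continuous_apply i).comp continuous_subtype_val)
  obtain ⟨T, hT⟩ := isCompact_univ.elim_finite_subcover _ hopen
    fun x _ => mem_iUnion.mpr ⟨x, fun _ _ => rfl⟩
  classical
  refine ⟨T.biUnion F, fun x y hxy => ?_⟩
  obtain ⟨z, hz, hzx⟩ := mem_iUnion₂.mp (hT (mem_univ x))
  rw [hF z x hzx, hF z y fun i hi =>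
    (hzx i hi).trans (hxy i (Finset.mem_biUnion.mpr ⟨z, hz, hi⟩))]

lemma setOf_le_height_subset {α : ℝ} (hα : Irrational α) (hαm : α ∈ Set.Ioo (0 : ℝ) 1)
    (w w' : ℤ × ℤ) (hle : (w.1 : ℝ) - w.2 * α ≤ w'.1 - w'.2 * α) :
    {x : ↥(sturmianZ α) | w'.1 ≤ height x.1 w'.2} ⊆ {x | w.1 ≤ height x.1 w.2} := by
  intro x (hx : w'.1 ≤ height x.1 w'.2)
  show w.1 ≤ height x.1 w.2
  by_contra hlt
  have hlt : height x.1 w.2 + 1 ≤ w.1 := not_le.mp hlt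
  have h := isLineHeight_height hαm x.2 w'.2 w.2
  have hlt' : (height x.1 w.2 : ℝ) + 1 ≤ w.1 := by exact_mod_cast hlt
  have hx' : (w'.1 : ℝ) ≤ height x.1 w'.2 := by exact_mod_cast hx
  have heq : (w.2 : ℝ) * α - w'.2 * α = height x.1 w.2 + 1 - height x.1 w'.2 := by
    linarith
  have hw : w.2 = w'.2 := by
    by_contra hne
    refine (hα.intCast_mul (sub_ne_zero.mpr hne)).ne_int
      (height x.1 w.2 + 1 - height x.1 w'.2) ?_
    push_cast
    linarith
  rw [hw] at heq
  linarith

lemma eq_of_height_eq {x y : ℤ → Bool} {i : ℤ} (h : height x i = height y i)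
    (h' : height x (i + 1) = height y (i + 1)) : x i = y i := by
  rw [height_add_one, height_add_one, h] at h'
  have h3 : (x i).toInt = (y i).toInt := add_left_cancel h'
  revert h3
  cases x i <;> cases y i <;> simp

lemma mem_almostConst_of_continuous {α : ℝ} (hα : Irrational α) (hαm : α ∈ Set.Ioo (0 : ℝ) 1)
    {N : ↥(sturmianZ α) → ℤ} (hN : Continuous N) : N ∈ almostConst α := by
  classical
  obtain ⟨F, hF⟩ := exists_window hN
  refine mem_of_forall_chain (almostConst α) (fun w : ℤ × ℤ => (w.1 : ℝ) - w.2 * α)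
    (fun w => {x | w.1 ≤ height x.1 w.2}) (setOf_le_height_subset hα hαm)
    (const_mem_almostConst α) (fun w => indicator_mem_almostConst hα hαm w.1 w.2)
    ((F ∪ F.image (· + 1)).image fun j : ℤ => (⌊j * α⌋ + 1, j)) N fun x y hxy => ?_
  have hh : ∀ j ∈ F ∪ F.image (· + 1), height x.1 j = height y.1 j := by
    intro j hj
    have h := hxy (⌊j * α⌋ + 1, j) (Finset.mem_image.mpr ⟨j, hj, rfl⟩)
    have h : ⌊j * α⌋ + 1 ≤ height x.1 j ↔ ⌊j * α⌋ + 1 ≤ height y.1 j := h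
    have h1 := height_mem_floor hα hαm x j
    have h2 := height_mem_floor hα hαm y j
    generalize ⌊j * α⌋ = m at h h1 h2
    generalize height x.1 j = p at h h1 h2 ⊢
    generalize height y.1 j = q at h h1 h2 ⊢
    clear hF hxy
    omega
  refine hF x y fun i hi => eq_of_height_eq (hh i (Finset.mem_union_left _ hi)) ?_
  exact hh (i + 1) (Finset.mem_union_right _ (Finset.mem_image.mpr ⟨i, hi, rfl⟩))

/-! ### Maps between suspensions and the circle -/

lemma coe_eq_coe_iff_exists_int (s t : ℝ) :
    (s : UnitAddCircle) = t ↔ ∃ n : ℤ, s = t + n := by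
  rw [← sub_eq_zero, ← AddCircle.coe_sub, AddCircle.coe_eq_zero_iff]
  refine exists_congr fun n => ?_
  rw [zsmul_one, eq_sub_iff_add_eq, add_comm, eq_comm]

lemma exists_continuous_lift_circle {f : ℝ → UnitAddCircle} (hf : Continuous f) :
    ∃ c : ℝ → ℝ, Continuous c ∧ ∀ t, (c t : UnitAddCircle) = f t := by
  obtain ⟨e, he⟩ := QuotientAddGroup.mk_surjective (f 0)
  obtain ⟨F, ⟨-, hF⟩, -⟩ := (AddCircle.isCoveringMap_coe (1 : ℝ)).existsUnique_continuousMap_lifts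
    ⟨f, hf⟩ 0 e he
  exact ⟨F, F.continuous, fun t => congrFun hF t⟩

/-- The projection `[x, s] ↦ s` of the suspension to the circle. -/
def timeProj {α : ℝ} : Suspension α → UnitAddCircle :=
  Quot.lift (fun p => (p.2 : UnitAddCircle)) (by
    rintro p q ⟨x, s, rfl, rfl⟩
    exact (coe_eq_coe_iff_exists_int _ _).mpr ⟨1, by simp⟩)

lemma timeProj_suspMk {α : ℝ} (x : ↥(sturmianZ α)) (s : ℝ) :
    timeProj (suspMk x s) = (s : UnitAddCircle) := rfl

lemma continuous_timeProj {α : ℝ} : Continuous (timeProj (α := α)) :=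
  continuous_quot_lift _ ((AddCircle.continuous_mk' 1).comp continuous_snd)

/-- The projection `[x, s] ↦ r(x) + α s` of the suspension to the circle, where `r(x)` is the
position of the height function of `x`. -/
def positionProj {α : ℝ} (hα : Irrational α) (hαm : α ∈ Set.Ioo (0 : ℝ) 1) :
    Suspension α → UnitAddCircle :=
  Quot.lift (fun p => ((position α (height p.1.1) + α * p.2 : ℝ) : UnitAddCircle)) (by
    rintro p q ⟨x, s, rfl, rfl⟩
    refine (coe_eq_coe_iff_exists_int _ _).mpr ⟨height x.1 1, ?_⟩
    simp only [sturmianShiftZ_eq, position_height_shiftPow hα hαm]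
    push_cast
    ring)

lemma positionProj_suspMk {α : ℝ} (hα : Irrational α) (hαm : α ∈ Set.Ioo (0 : ℝ) 1)
    (x : ↥(sturmianZ α)) (s : ℝ) : positionProj hα hαm (suspMk x s) =
      ((position α (height x.1) + α * s : ℝ) : UnitAddCircle) := rfl

lemma continuous_positionProj {α : ℝ} (hα : Irrational α) (hαm : α ∈ Set.Ioo (0 : ℝ) 1) :
    Continuous (positionProj hα hαm) := by
  refine continuous_quot_lift _ ((AddCircle.continuous_mk' 1).comp ?_)
  have h : Continuous fun x : ↥(sturmianZ α) => position α (height x.1) :=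
    (continuousOn_position hα).comp
      (f := fun x : ↥(sturmianZ α) => (⟨height x.1, isLineHeight_height hαm x.2⟩ :
        {H // IsLineHeight α H}))
      ((continuous_height.comp continuous_subtype_val).subtype_mk _)
  exact (h.comp continuous_fst).add (continuous_const.mul continuous_snd)

lemma isOpen_image_suspMk {α : ℝ} {U : Set (↥(sturmianZ α) × ℝ)} (hU : IsOpen U) :
    IsOpen ((fun p : ↥(sturmianZ α) × ℝ => suspMk p.1 p.2) '' U) := by
  have hq : Topology.IsQuotientMap fun p : ↥(sturmianZ α) × ℝ => suspMk p.1 p.2 :=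
    isQuotientMap_quot_mk
  rw [← hq.isOpen_preimage]
  have : (fun p : ↥(sturmianZ α) × ℝ => suspMk p.1 p.2) ⁻¹'
      ((fun p : ↥(sturmianZ α) × ℝ => suspMk p.1 p.2) '' U) =
      ⋃ n : ℤ, (fun p : ↥(sturmianZ α) × ℝ => (shiftPow n p.1, p.2 - n)) ⁻¹' U := by
    ext ⟨x, s⟩
    simp only [mem_preimage, mem_image, mem_iUnion, Prod.exists]
    constructor
    · rintro ⟨y, t, hU, h⟩
      obtain ⟨n, rfl, rfl⟩ := (suspMk_eq_iff x y s t).mp h.symm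
      exact ⟨n, by simpa using hU⟩
    · rintro ⟨n, hn⟩
      exact ⟨_, _, hn, by rw [suspMk_shiftPow]; simp⟩
  rw [this]
  exact isOpen_iUnion fun n => hU.preimage
    (((continuous_shiftPow n).comp continuous_fst).prodMk (continuous_snd.sub continuous_const))

/-- A path in the suspension stays in one flow line. -/
lemma exists_eq_suspMk_of_continuous {α : ℝ} {γ : ℝ → Suspension α} (hγ : Continuous γ) :
    ∃ (x : ↥(sturmianZ α)) (c : ℝ → ℝ), Continuous c ∧ ∀ t, γ t = suspMk x (c t) := by
  obtain ⟨c, hc, hcγ⟩ := exists_continuous_lift_circle (continuous_timeProj.comp hγ)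
  have hex : ∀ t, ∃ y, γ t = suspMk y (c t) := by
    intro t
    obtain ⟨y, s, hys⟩ := exists_suspMk_eq (γ t)
    have h : (c t : UnitAddCircle) = s := by rw [hcγ, Function.comp_apply, ← hys]; rfl
    obtain ⟨n, hn⟩ := (coe_eq_coe_iff_exists_int _ _).mp h
    refine ⟨shiftPow (-n) y, ?_⟩
    rw [suspMk_shiftPow, ← hys, hn]
    simp
  choose y hy using hex
  have hloc : ∀ i, IsLocallyConstant fun t => (y t).1 i := by
    intro i
    rw [IsLocallyConstant.iff_eventually_eq]
    intro t₀
    have hU : IsOpen {p : ↥(sturmianZ α) × ℝ | p.1.1 i = (y t₀).1 i ∧ |p.2 - c t₀| < 1 / 2} := by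
      have h : IsOpen ((fun p : ↥(sturmianZ α) × ℝ => p.1.1 i) ⁻¹' {(y t₀).1 i}) :=
        (isOpen_discrete _).preimage
          ((continuous_apply i).comp (continuous_subtype_val.comp continuous_fst))
      exact h.and (isOpen_lt (continuous_snd.sub continuous_const).abs continuous_const)
    have h1 : ∀ᶠ t in nhds t₀, γ t ∈ (fun p : ↥(sturmianZ α) × ℝ => suspMk p.1 p.2) ''
        {p | p.1.1 i = (y t₀).1 i ∧ |p.2 - c t₀| < 1 / 2} :=
      hγ.continuousAt.eventually_mem ((isOpen_image_suspMk hU).mem_nhds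
        ⟨(y t₀, c t₀), ⟨rfl, by simp⟩, (hy t₀).symm⟩)
    have h2 : ∀ᶠ t in nhds t₀, |c t - c t₀| < 1 / 2 :=
      (isOpen_lt (hc.sub continuous_const).abs continuous_const).mem_nhds (by simp)
    filter_upwards [h1, h2] with t ht ht'
    obtain ⟨⟨z, s⟩, ⟨hz, hs⟩, hzs⟩ := ht
    simp only at hz hs hzs
    rw [hy t] at hzs
    obtain ⟨n, hn, hsn⟩ := (suspMk_eq_iff _ _ _ _).mp hzs
    have hn0 : n = 0 := by
      rw [abs_lt] at hs ht'
      have h3 : (n : ℝ) < 1 := by linarith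
      have h4 : (-1 : ℝ) < n := by linarith
      have h5 : n < 1 := by exact_mod_cast h3
      have h6 : -1 < n := by exact_mod_cast h4
      omega
    rw [hn, hn0, shiftPow_zero, hz]
  refine ⟨y 0, c, hc, fun t => ?_⟩
  have : y t = y 0 := Subtype.ext (funext fun i => (hloc i).apply_eq_of_isPreconnected
    isPreconnected_univ (mem_univ t) (mem_univ 0))
  rw [hy t, this]

lemma exists_continuous_lift_of_totallyDisconnected {X : Type*} [TopologicalSpace X]
    [CompactSpace X] [T2Space X] [TotallyDisconnectedSpace X] {g : X → UnitAddCircle}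
    (hg : Continuous g) : ∃ G : X → ℝ, Continuous G ∧ ∀ x, (G x : UnitAddCircle) = g x := by
  classical
  have hne : (0 : UnitAddCircle) ≠ ((1 / 2 : ℝ) : UnitAddCircle) := by
    intro h
    obtain ⟨n, hn⟩ := (coe_eq_coe_iff_exists_int 0 (1 / 2)).mp h
    have h2 : ((2 * n : ℤ) : ℝ) = (-1 : ℤ) := by
      push_cast
      linarith
    have h3 : 2 * n = -1 := by exact_mod_cast h2
    omega
  obtain ⟨D, hD, hD0, hD1⟩ := exists_clopen_of_closed_subset_open
    (Z := g ⁻¹' {0}) (U := g ⁻¹' {((1 / 2 : ℝ) : UnitAddCircle)}ᶜ)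
    (isClosed_singleton.preimage hg) (isOpen_compl_singleton.preimage hg)
    (fun x (hx : g x = 0) (h : g x = _) => hne (hx.symm.trans h))
  have hcont : ∀ a : ℝ, ∀ x, g x ≠ (a : UnitAddCircle) →
      ContinuousAt (fun x => (AddCircle.equivIco 1 a (g x) : ℝ)) x := fun a x hx =>
    continuousAt_subtype_val.comp
      ((AddCircle.continuousAt_equivIco 1 a hx).comp (f := g) hg.continuousAt)
  refine ⟨fun x => if x ∈ D then AddCircle.equivIco 1 (1 / 2 : ℝ) (g x)
    else AddCircle.equivIco 1 (0 : ℝ) (g x), ?_, fun x => ?_⟩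
  · refine continuous_iff_continuousAt.mpr fun x => ?_
    by_cases hx : x ∈ D
    · refine (hcont (1 / 2) x fun h => hD1 hx h).congr ?_
      filter_upwards [hD.isOpen.mem_nhds hx] with z hz
      rw [if_pos hz]
    · refine (hcont 0 x fun h => hx (hD0 h)).congr ?_
      filter_upwards [hD.compl.isOpen.mem_nhds hx] with z hz
      rw [if_neg hz]
  · dsimp only
    split_ifs <;> exact AddCircle.coe_equivIco

lemma exists_continuous_int {X : Type*} [TopologicalSpace X] {f g : X → ℝ} (hf : Continuous f)
    (hg : Continuous g) (h : ∀ x, (f x : UnitAddCircle) = g x) :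
    ∃ N : X → ℤ, Continuous N ∧ ∀ x, f x = g x + N x := by
  choose N hN using fun x => (coe_eq_coe_iff_exists_int _ _).mp (h x)
  refine ⟨N, Int.isClosedEmbedding_coe_real.isEmbedding.continuous_iff.mpr ?_, hN⟩
  exact (hf.sub hg).congr fun x => by simp [hN x]

lemma exists_eq_add_int {X : Type*} [TopologicalSpace X] [PreconnectedSpace X] [Nonempty X]
    {f g : X → ℝ} (hf : Continuous f) (hg : Continuous g)
    (h : ∀ x, (f x : UnitAddCircle) = g x) : ∃ n : ℤ, ∀ x, f x = g x + n := by
  obtain ⟨N, hN, hfg⟩ := exists_continuous_int hf hg h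
  obtain ⟨x₀⟩ := ‹Nonempty X›
  exact ⟨N x₀, fun x => by rw [hfg x, PreconnectedSpace.constant ‹_› hN]⟩

lemma exists_flow_lift {α : ℝ} {φ : Suspension α → UnitAddCircle} (hφ : Continuous φ) :
    ∃ Θ : unitInterval × ↥(sturmianZ α) → ℝ, Continuous Θ ∧
      ∀ s x, (Θ (s, x) : UnitAddCircle) = φ (suspMk x s) := by
  have hH : Continuous fun p : unitInterval × ↥(sturmianZ α) => φ (suspMk p.2 p.1) :=
    hφ.comp (continuous_suspMk.comp
      (continuous_snd.prodMk (continuous_subtype_val.comp continuous_fst)))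
  obtain ⟨G, hG, hGφ⟩ := exists_continuous_lift_of_totallyDisconnected
    (hH.comp (Continuous.prodMk_right (0 : unitInterval)))
  have cov := AddCircle.isCoveringMap_coe (1 : ℝ)
  exact ⟨cov.liftHomotopy ⟨_, hH⟩ ⟨G, hG⟩ fun x => (hGφ x).symm, ContinuousMap.continuous _,
    fun s x => congrFun (cov.liftHomotopy_lifts ⟨_, hH⟩ ⟨G, hG⟩ fun x => (hGφ x).symm) (s, x)⟩

lemma sub_eq_of_step {α ρ : ℝ} {N : ↥(sturmianZ α) → ℤ} {B : ↥(sturmianZ α) → ℝ}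
    (hN : ∀ x, (N x : ℝ) = ρ + B (shiftPow 1 x) - B x) (x : ↥(sturmianZ α)) {k : ℤ → ℤ}
    (hk : ∀ n, k (n + 1) - k n = N (shiftPow n x)) (n : ℤ) :
    (k n : ℝ) - k 0 = ρ * n + B (shiftPow n x) - B x := by
  have hstep : ∀ n : ℤ, (k (n + 1) : ℝ) - k n =
      ρ + B (shiftPow (n + 1) x) - B (shiftPow n x) := by
    intro n
    rw [← Int.cast_sub, hk, hN, shiftPow_shiftPow, add_comm 1 n]
  induction n using Int.induction_on with
  | zero => simp [shiftPow_zero]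
  | succ n ih =>
    have := hstep n
    push_cast at ih ⊢
    linarith
  | pred n ih =>
    have := hstep (-n - 1)
    rw [sub_add_cancel] at this
    push_cast at ih ⊢
    linarith

/-- Every map from the suspension to the circle winds along the flow lines at a constant rate in
`ℤ + αℤ`, up to a bounded error. -/
lemma exists_winding_rate {α : ℝ} (hα : Irrational α) (hαm : α ∈ Set.Ioo (0 : ℝ) 1)
    {φ : Suspension α → UnitAddCircle} (hφ : Continuous φ) :
    ∃ ρ ∈ ZplusAZ α, ∀ (x : ↥(sturmianZ α)) (θ : ℝ → ℝ), Continuous θ →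
      (∀ t, (θ t : UnitAddCircle) = φ (suspMk x t)) → ∃ C, ∀ t, |θ t - ρ * t| ≤ C := by
  obtain ⟨Θ, hΘ, hΘφ⟩ := exists_flow_lift hφ
  obtain ⟨K, hK⟩ := isCompact_univ.exists_bound_of_continuousOn hΘ.continuousOn
  obtain ⟨N, hNc, hN⟩ := exists_continuous_int
    (hΘ.comp (Continuous.prodMk_right (1 : unitInterval)))
    (hΘ.comp ((Continuous.prodMk_right (0 : unitInterval)).comp (continuous_shiftPow 1)))
    (fun x => by
      simp only [Function.comp_apply]
      rw [hΘφ, hΘφ, suspMk_shiftPow]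
      simp)
  obtain ⟨ρ, hρ, B, C, hB, hNB⟩ := mem_almostConst_of_continuous hα hαm hNc
  refine ⟨ρ, hρ, fun x θ hθ hθφ => ?_⟩
  have hex : ∀ n : ℤ, ∃ k : ℤ, ∀ s : unitInterval, θ (n + s) = Θ (s, shiftPow n x) + k := by
    intro n
    refine exists_eq_add_int (hθ.comp (continuous_const.add continuous_subtype_val))
      (hΘ.comp (Continuous.prodMk_left (shiftPow n x))) fun s => ?_
    show (θ (n + s) : UnitAddCircle) = Θ (s, shiftPow n x)
    rw [hθφ, hΘφ, suspMk_shiftPow, add_comm]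
  choose k hk using hex
  have hstep : ∀ n, k (n + 1) - k n = N (shiftPow n x) := by
    intro n
    have h0 := hk (n + 1) 0
    have h1 := hk n 1
    have h2 := hN (shiftPow n x)
    simp only [Function.comp_apply, shiftPow_shiftPow, add_comm 1 n] at h2
    push_cast at h0
    simp only [Icc.coe_one, add_zero] at h0 h1
    have h3 : ((k (n + 1) - k n : ℤ) : ℝ) = N (shiftPow n x) := by
      push_cast
      linarith
    exact_mod_cast h3
  refine ⟨K + |(k 0 : ℝ)| + (C + C) + |ρ|, fun t => ?_⟩
  have h1 := hk ⌊t⌋ ⟨Int.fract t, Int.fract_nonneg t, (Int.fract_lt_one t).le⟩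
  have h2 := sub_eq_of_step hNB x hstep ⌊t⌋
  have h3 := hK (⟨Int.fract t, Int.fract_nonneg t, (Int.fract_lt_one t).le⟩, shiftPow ⌊t⌋ x)
    (mem_univ _)
  simp only [Int.floor_add_fract] at h1
  have h4 : θ t - ρ * t = Θ (⟨Int.fract t, Int.fract_nonneg t, (Int.fract_lt_one t).le⟩,
      shiftPow ⌊t⌋ x) + k 0 + (B (shiftPow ⌊t⌋ x) - B x) - ρ * Int.fract t := by
    have : ρ * t = ρ * ⌊t⌋ + ρ * Int.fract t := by rw [← mul_add, Int.floor_add_fract]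
    linarith
  have h5 : |ρ * Int.fract t| ≤ |ρ| := by
    rw [abs_mul, Int.abs_fract]
    exact mul_le_of_le_one_right (abs_nonneg _) (Int.fract_lt_one t).le
  rw [h4]
  refine (abs_sub _ _).trans (add_le_add ((abs_add_le _ _).trans (add_le_add
    ((abs_add_le _ _).trans (add_le_add h3 le_rfl)) ?_)) h5)
  exact (abs_sub _ _).trans (add_le_add (hB _) (hB _))

/-! ### Homeomorphic suspensions come from equivalent irrationals -/

lemma eq_of_forall_abs_sub_le {a b M : ℝ} (h : ∀ t : ℝ, |a * t - b * t| ≤ M) : a = b := by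
  by_contra hne
  have hpos : 0 < |a - b| := abs_pos.mpr (sub_ne_zero.mpr hne)
  have h1 := h ((|M| + 1) / |a - b|)
  rw [← sub_mul, abs_mul, abs_div, abs_abs, mul_div_cancel₀ _ hpos.ne',
    abs_of_nonneg (by positivity)] at h1
  linarith [le_abs_self M]

lemma int_add_mul_inj {α : ℝ} (hα : Irrational α) {p q r s : ℤ}
    (h : (p : ℝ) + q * α = r + s * α) : p = r ∧ q = s := by
  have hq : q = s := by
    by_contra hne
    refine (hα.intCast_mul (sub_ne_zero.mpr hne)).ne_int (r - p) ?_
    push_cast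
    linarith
  subst hq
  have h1 : (p : ℝ) = r := by linarith
  exact ⟨by exact_mod_cast h1, rfl⟩

/-- A continuous map between suspensions stretches the flow lines by an asymptotic factor `κ`
such that `κ` and `β κ` both lie in `ℤ + αℤ`. -/
lemma exists_stretch_rate {α β : ℝ} (hα : Irrational α) (hβ : Irrational β)
    (hαm : α ∈ Set.Ioo (0 : ℝ) 1) (hβm : β ∈ Set.Ioo (0 : ℝ) 1)
    {f : Suspension α → Suspension β} (hf : Continuous f) {x : ↥(sturmianZ α)}
    {y : ↥(sturmianZ β)} {c : ℝ → ℝ} (hc : Continuous c)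
    (hfc : ∀ t, f (suspMk x t) = suspMk y (c t)) :
    ∃ κ ∈ ZplusAZ α, β * κ ∈ ZplusAZ α ∧ ∃ C, ∀ t, |c t - κ * t| ≤ C := by
  obtain ⟨κ, hκ, h⟩ := exists_winding_rate hα hαm (continuous_timeProj.comp hf)
  obtain ⟨μ, hμ, h'⟩ := exists_winding_rate hα hαm ((continuous_positionProj hβ hβm).comp hf)
  obtain ⟨C, hC⟩ := h x c hc fun t => by rw [Function.comp_apply, hfc, timeProj_suspMk]
  obtain ⟨C', hC'⟩ := h' x (fun t => position β (height y.1) + β * c t)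
    (continuous_const.add (continuous_const.mul hc))
    fun t => by rw [Function.comp_apply, hfc, positionProj_suspMk]
  have hμκ : β * κ = μ := by
    refine eq_of_forall_abs_sub_le (M := C' + |β| * C + |position β (height y.1)|) fun t => ?_
    have h1 : β * κ * t - μ * t = (position β (height y.1) + β * c t - μ * t) -
        β * (c t - κ * t) - position β (height y.1) := by ring
    rw [h1]
    refine (abs_sub _ _).trans (add_le_add ((abs_sub _ _).trans (add_le_add (hC' t) ?_)) le_rfl)
    rw [abs_mul]
    exact mul_le_mul_of_nonneg_left (hC t) (abs_nonneg _)
  exact ⟨κ, hκ, hμκ ▸ hμ, C, hC⟩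

lemma mul_eq_one_of_comp_eq_add {c c' : ℝ → ℝ} {κ κ' C C' e : ℝ} (hc : ∀ t, |c t - κ * t| ≤ C)
    (hc' : ∀ t, |c' t - κ' * t| ≤ C') (h : ∀ t, c' (c t) = t + e) : κ * κ' = 1 := by
  refine eq_of_forall_abs_sub_le (M := |e| + C' + |κ'| * C) fun t => ?_
  have h1 : κ * κ' * t - 1 * t = e - (c' (c t) - κ' * c t) - κ' * (c t - κ * t) := by
    rw [h]
    ring
  rw [h1]
  refine (abs_sub _ _).trans (add_le_add ((abs_sub _ _).trans (add_le_add le_rfl (hc' _))) ?_)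
  rw [abs_mul]
  exact mul_le_mul_of_nonneg_left (hc t) (abs_nonneg _)

lemma irrationalEquiv_of_mul_eq_one {α β κ κ' : ℝ} (hα : Irrational α) (hκ : κ ∈ ZplusAZ α)
    (hβκ : β * κ ∈ ZplusAZ α) (hκ' : κ' ∈ ZplusAZ β) (hακ' : α * κ' ∈ ZplusAZ β)
    (h : κ * κ' = 1) : IrrationalEquiv α β := by
  obtain ⟨d, c, hdc⟩ := hκ
  obtain ⟨b, a, hba⟩ := hβκ
  obtain ⟨d', c', hdc'⟩ := hκ'
  obtain ⟨b', a', hba'⟩ := hακ'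
  obtain ⟨h1, h2⟩ : d' * d + c' * b = 1 ∧ d' * c + c' * a = 0 := by
    refine int_add_mul_inj hα ?_
    push_cast
    linear_combination h + κ * -hdc' - d' * hdc - c' * hba
  obtain ⟨h3, h4⟩ : b' * d + a' * b = 0 ∧ b' * c + a' * a = 1 := by
    refine int_add_mul_inj hα ?_
    push_cast
    linear_combination α * h - κ * hba' - b' * hdc - a' * hba
  refine ⟨a, b, c, d, ?_, ?_⟩
  · refine Int.eq_one_or_neg_one_of_mul_eq_one (v := d' * a' - c' * b') ?_
    linear_combination h1 * (b' * c + a' * a) + h4 - h2 * (b' * d + a' * b)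
  · have hne : κ ≠ 0 := left_ne_zero_of_mul_eq_one h
    rw [add_comm, ← hba, add_comm ((c : ℝ) * α), ← hdc, mul_div_cancel_right₀ _ hne]

lemma irrationalEquiv_of_homeomorph {α β : ℝ} (hα : Irrational α) (hβ : Irrational β)
    (hαm : α ∈ Set.Ioo (0 : ℝ) 1) (hβm : β ∈ Set.Ioo (0 : ℝ) 1)
    (h : Suspension α ≃ₜ Suspension β) : IrrationalEquiv α β := by
  let x : ↥(sturmianZ α) := ⟨sturmianSeqZ α 0, subset_closure ⟨0, rfl⟩⟩
  have hflow : ∀ {α : ℝ} (x : ↥(sturmianZ α)), Continuous fun t : ℝ => suspMk x t := fun x =>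
    continuous_suspMk.comp (Continuous.prodMk_right x)
  obtain ⟨y, c, hc, hxy⟩ := exists_eq_suspMk_of_continuous (h.continuous.comp (hflow x))
  obtain ⟨z, c', hc', hyz⟩ := exists_eq_suspMk_of_continuous (h.symm.continuous.comp (hflow y))
  obtain ⟨κ, hκ, hβκ, C, hC⟩ := exists_stretch_rate hα hβ hαm hβm h.continuous hc hxy
  obtain ⟨κ', hκ', hακ', C', hC'⟩ := exists_stretch_rate hβ hα hβm hαm h.symm.continuous hc' hyz
  obtain ⟨n, hn⟩ : ∃ n : ℤ, ∀ t, c' (c t) = t + n := by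
    refine exists_eq_add_int (hc'.comp hc) continuous_id fun t => ?_
    have h1 : suspMk z (c' (c t)) = suspMk x t := by
      rw [← hyz, Function.comp_apply, ← hxy, Function.comp_apply, h.symm_apply_apply]
    exact congrArg timeProj h1
  exact irrationalEquiv_of_mul_eq_one hα hκ hβκ hκ' hακ' (mul_eq_one_of_comp_eq_add hC hC' hn)

/-- The suspension spaces of the two-sided Sturmian subshifts `(Λ_α, σ_α)` and
`(Λ_β, σ_β)` are homeomorphic if and only if `α` and `β` are equivalent irrationals. -/
theorem sturmian_suspension_homeomorphic_iff (α β : ℝ) (hα : Irrational α) (hβ : Irrational β)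
    (hαm : α ∈ Set.Ioo (0 : ℝ) 1) (hβm : β ∈ Set.Ioo (0 : ℝ) 1) :
    Nonempty (Suspension α ≃ₜ Suspension β) ↔ IrrationalEquiv α β := by
  exact ⟨fun ⟨h⟩ => irrationalEquiv_of_homeomorph hα hβ hαm hβm h,
    nonempty_homeomorph_of_irrationalEquiv hα hβ hαm hβm⟩

end
end

section
/- Let α, β ∈ (0,1) be irrational. The two-sided Sturmian subshifts (Λ_α, σ_α) and (Λ_β, σ_β) are flow equivalent if and only if α ∼ β, i.e. α and β are equivalent irrationals. -/
noncomputable section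

open Set

/-! ### The cut line -/

/-- The value `m + n α` of a pair of integers. -/
def latticeVal (α : ℝ) (g : ℤ × ℤ) : ℝ := g.1 + g.2 * α

lemma latticeVal_sub (α : ℝ) (g h : ℤ × ℤ) :
    latticeVal α (g - h) = latticeVal α g - latticeVal α h := by
  simp only [latticeVal, Prod.fst_sub, Prod.snd_sub]
  push_cast
  ring

/-- The values `m + n α` are dense in the line when `α` is irrational. -/
lemma exists_latticeVal_btwn {α : ℝ} (hα : Irrational α) {a b : ℝ} (hab : a < b) :
    ∃ g, a < latticeVal α g ∧ latticeVal α g < b := by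
  have hd : Dense (AddSubgroup.closure {α, 1} : Set ℝ) :=
    dense_addSubgroupClosure_pair_iff.2 (by simpa using hα)
  obtain ⟨x, hx, hax, hxb⟩ := hd.exists_between hab
  obtain ⟨n, m, rfl⟩ := AddSubgroup.mem_closure_pair.1 hx
  refine ⟨(m, n), ?_⟩
  have : latticeVal α (m, n) = n • α + m • (1 : ℝ) := by simp [latticeVal, add_comm]
  rw [this]
  exact ⟨hax, hxb⟩

/-- A Dedekind cut of `ℤ + αℤ`, indexed by `ℤ × ℤ`; the two cuts at an element of `ℤ + αℤ`
are distinguished. -/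
def IsCut (α : ℝ) (y : ℤ × ℤ → Bool) : Prop :=
  (∀ g h, latticeVal α g ≤ latticeVal α h → y h = true → y g = true) ∧
    (∃ g, y g = true) ∧ ∃ g, y g = false

/-- The line with all points of `ℤ + αℤ` doubled. -/
abbrev CutLine (α : ℝ) : Type := {y : ℤ × ℤ → Bool // IsCut α y}

lemma CutLine.continuous_apply {α : ℝ} (g : ℤ × ℤ) : Continuous fun y : CutLine α => y.1 g :=
  (_root_.continuous_apply g).comp continuous_subtype_val

/-- The translate of a cut by an element of `ℤ + αℤ`. -/
def CutLine.translate {α : ℝ} (y : CutLine α) (g : ℤ × ℤ) : CutLine α :=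
  ⟨fun h => y.1 (h - g), fun h k hhk => y.2.1 _ _ (by
      rw [latticeVal_sub, latticeVal_sub]; linarith),
    y.2.2.1.imp' (· + g) fun h hh => by simpa using hh,
    y.2.2.2.imp' (· + g) fun h hh => by simpa using hh⟩

/-- The upper cut at a real number. -/
def CutLine.ofReal (α t : ℝ) : CutLine α :=
  ⟨fun g => decide (latticeVal α g ≤ t), fun g h hgh hh => by
      simp only [decide_eq_true_eq] at hh ⊢; linarith,
    ⟨(⌊t⌋, 0), by simpa [latticeVal] using Int.floor_le t⟩,
    ⟨(⌊t⌋ + 1, 0), by simp [latticeVal]⟩⟩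

lemma CutLine.exists_floor {α : ℝ} (y : CutLine α) (n : ℤ) :
    ∃ m : ℤ, ∀ k : ℤ, y.1 (k, -n) = true ↔ k ≤ m := by
  obtain ⟨hmono, ⟨g, hg⟩, ⟨h, hh⟩⟩ := y.2
  have hle : ∀ k : ℤ, y.1 (k, -n) = true → (k : ℝ) ≤ latticeVal α h + n * α := by
    intro k hk
    by_contra! hlt
    have := hmono h (k, -n) (by simp only [latticeVal] at hlt ⊢; push_cast; linarith) hk
    simp [this] at hh
  obtain ⟨m, hm, hmax⟩ := Int.exists_greatest_of_bdd (P := fun k => y.1 (k, -n) = true)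
    ⟨⌊latticeVal α h + n * α⌋, fun k hk => Int.le_floor.2 (hle k hk)⟩
    ⟨⌊latticeVal α g + n * α⌋, hmono _ g (by
      have := Int.floor_le (latticeVal α g + n * α)
      simp only [latticeVal] at this ⊢; push_cast; linarith) hg⟩
  refine ⟨m, fun k => ⟨hmax k, fun hk => hmono _ _ ?_ hm⟩⟩
  have : (k : ℝ) ≤ m := by exact_mod_cast hk
  simp only [latticeVal]
  linarith

/-- The integer part of the translate of a cut by `n α`. -/
def CutLine.floor {α : ℝ} (y : CutLine α) (n : ℤ) : ℤ := (y.exists_floor n).choose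

lemma CutLine.le_floor {α : ℝ} (y : CutLine α) (k n : ℤ) :
    k ≤ y.floor n ↔ y.1 (k, -n) = true := ((y.exists_floor n).choose_spec k).symm

lemma CutLine.floor_eq {α : ℝ} (y : CutLine α) (n m : ℤ)
    (h : ∀ k : ℤ, y.1 (k, -n) = true ↔ k ≤ m) : y.floor n = m :=
  le_antisymm ((h _).1 ((y.le_floor _ _).1 le_rfl)) ((y.le_floor _ _).2 ((h _).2 le_rfl))

lemma CutLine.continuous_floor {α : ℝ} (n : ℤ) : Continuous fun y : CutLine α => y.floor n := by
  refine continuous_discrete_rng.2 fun m => ?_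
  have : (fun y : CutLine α => y.floor n) ⁻¹' {m} =
      (fun y : CutLine α => y.1 (m, -n)) ⁻¹' {true} ∩
        (fun y : CutLine α => y.1 (m + 1, -n)) ⁻¹' {false} := by
    ext y
    have h1 := y.le_floor m n
    have h2 := y.le_floor (m + 1) n
    simp only [mem_preimage, mem_singleton_iff, mem_inter_iff, ← Bool.not_eq_true, ← h1, ← h2]
    omega
  rw [this]
  exact ((isOpen_discrete _).preimage (CutLine.continuous_apply _)).inter
    ((isOpen_discrete _).preimage (CutLine.continuous_apply _))

lemma CutLine.floor_translate {α : ℝ} (y : CutLine α) (g : ℤ × ℤ) (n : ℤ) :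
    (y.translate g).floor n = y.floor (n + g.2) + g.1 := by
  refine CutLine.floor_eq _ _ _ fun k => ?_
  have := y.le_floor (k - g.1) (n + g.2)
  have e : ((k, -n) - g : ℤ × ℤ) = (k - g.1, -(n + g.2)) := by
    ext <;> simp; ring
  change y.1 ((k, -n) - g) = true ↔ _
  rw [e, ← this, sub_le_iff_le_add]

lemma CutLine.floor_ofReal (α t : ℝ) (n : ℤ) :
    (CutLine.ofReal α t).floor n = ⌊t + n * α⌋ := by
  refine CutLine.floor_eq _ _ _ fun k => ?_
  rw [Int.le_floor]
  change decide (latticeVal α (k, -n) ≤ t) = true ↔ _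
  rw [decide_eq_true_eq, latticeVal]
  push_cast
  constructor <;> intro <;> linarith

lemma CutLine.ext_floor {α : ℝ} {y z : CutLine α} (h : ∀ n, y.floor n = z.floor n) : y = z := by
  refine Subtype.ext (funext fun ⟨m, n⟩ => Bool.eq_iff_iff.2 ?_)
  have hy := y.le_floor m (-n)
  have hz := z.le_floor m (-n)
  rw [neg_neg] at hy hz
  rw [← hy, ← hz, h]

lemma CutLine.floor_succ {α : ℝ} (hα : α ∈ Ioo (0 : ℝ) 1) (y : CutLine α) (n : ℤ) :
    y.floor (n + 1) = y.floor n ∨ y.floor (n + 1) = y.floor n + 1 := by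
  have h1 : y.floor n ≤ y.floor (n + 1) := by
    rw [CutLine.le_floor]
    refine y.2.1 _ _ ?_ ((y.le_floor _ n).1 le_rfl)
    simp only [latticeVal]; push_cast; nlinarith [hα.1]
  have h2 : y.floor (n + 1) - 1 ≤ y.floor n := by
    rw [CutLine.le_floor]
    refine y.2.1 _ _ ?_ ((y.le_floor _ (n + 1)).1 le_rfl)
    simp only [latticeVal]; push_cast; nlinarith [hα.2]
  omega

/-- The Sturmian coding of a cut. -/
def CutLine.code {α : ℝ} (y : CutLine α) : ℤ → Bool :=
  fun i => decide (y.floor i < y.floor (i + 1))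

lemma CutLine.continuous_code {α : ℝ} : Continuous (CutLine.code (α := α)) :=
  continuous_pi fun i => (continuous_of_discreteTopology (f := fun p : ℤ × ℤ => decide (p.1 < p.2))).comp
    ((CutLine.continuous_floor i).prodMk (CutLine.continuous_floor (i + 1)))

lemma CutLine.code_translate {α : ℝ} (y : CutLine α) (g : ℤ × ℤ) (i : ℤ) :
    (y.translate g).code i = y.code (i + g.2) := by
  simp only [CutLine.code, CutLine.floor_translate, add_lt_add_iff_right]
  rw [add_right_comm]

lemma CutLine.code_ofReal (α t : ℝ) :
    (CutLine.ofReal α t).code = sturmianSeqZ α t := by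
  funext i
  simp only [CutLine.code, CutLine.floor_ofReal, sturmianSeqZ, sturmianCode]
  congr 1
  rw [eq_iff_iff, Int.fract, ← Int.add_one_le_iff, Int.le_floor]
  push_cast
  constructor <;> intro <;> linarith

lemma sturmianSeqZ_fract (α t : ℝ) : sturmianSeqZ α (Int.fract t) = sturmianSeqZ α t := by
  funext i
  simp only [sturmianSeqZ, sturmianCode]
  have : t + i * α = Int.fract t + i * α + ⌊t⌋ := by
    rw [← Int.self_sub_floor]; ring
  rw [this, Int.fract_add_intCast]

lemma CutLine.floor_add_one {α : ℝ} (hα : α ∈ Ioo (0 : ℝ) 1) (y : CutLine α) (n : ℤ) :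
    y.floor (n + 1) = y.floor n + if y.code n then 1 else 0 := by
  have := y.floor_succ hα n
  simp only [CutLine.code, decide_eq_true_eq]
  split_ifs <;> omega

lemma CutLine.eq_of_code_eq {α : ℝ} (hα : α ∈ Ioo (0 : ℝ) 1) {y z : CutLine α}
    (h : y.code = z.code) (h0 : y.floor 0 = z.floor 0) : y = z := by
  refine CutLine.ext_floor fun n => ?_
  induction n using Int.induction_on with
  | zero => exact h0
  | succ n ih => rw [y.floor_add_one hα, z.floor_add_one hα, ih, h]
  | pred n ih =>
    have hy := y.floor_add_one hα (-n - 1)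
    have hz := z.floor_add_one hα (-n - 1)
    rw [sub_add_cancel] at hy hz
    rw [h] at hy
    omega

lemma CutLine.exists_translate_of_code_eq {α : ℝ} (hα : α ∈ Ioo (0 : ℝ) 1) {y z : CutLine α}
    (h : y.code = z.code) : ∃ m : ℤ, z = y.translate (m, 0) := by
  refine ⟨z.floor 0 - y.floor 0, CutLine.eq_of_code_eq hα ?_ ?_⟩
  · funext i
    rw [CutLine.code_translate, ← h, add_zero]
  · rw [CutLine.floor_translate]
    simp

lemma CutLine.code_mem {α : ℝ} (y : CutLine α) :
    y.code ∈ sturmianZ α := by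
  have hy : y ∈ closure (range (CutLine.ofReal α)) := by
    rw [closure_subtype, mem_closure_iff]
    intro U hU hyU
    obtain ⟨S, u, hu, hS⟩ := isOpen_pi_iff.1 hU _ hyU
    obtain ⟨g₀, hg₀⟩ := y.2.2.1
    classical
    let T := insert g₀ (S.filter fun g => y.1 g = true)
    obtain ⟨g₁, hg₁, hmax⟩ := T.exists_max_image (latticeVal α) ⟨g₀, by simp [T]⟩
    have hg₁' : y.1 g₁ = true := by
      simp only [T, Finset.mem_insert, Finset.mem_filter] at hg₁
      rcases hg₁ with rfl | h
      exacts [hg₀, h.2]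
    refine ⟨_, hS fun g hg => ?_, mem_image_of_mem _ (mem_range_self (latticeVal α g₁))⟩
    have : (CutLine.ofReal α (latticeVal α g₁)).1 g = y.1 g := by
      refine Bool.eq_iff_iff.2 ?_
      simp only [CutLine.ofReal, decide_eq_true_eq]
      exact ⟨fun h => y.2.1 _ _ h hg₁', fun h => hmax g (by
        have hg' : g ∈ S := hg
        simp [T, hg', h])⟩
    rw [this]
    exact (hu g hg).2
  have hm : MapsTo CutLine.code (range (CutLine.ofReal α))
      {x : ℤ → Bool | ∃ t : ℝ, x = sturmianSeqZ α t} := by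
    rintro _ ⟨t, rfl⟩
    exact ⟨t, CutLine.code_ofReal α t⟩
  exact hm.closure CutLine.continuous_code hy

/-- The cuts lying between `0⁺` and `1⁻`. -/
def unitCuts (α : ℝ) : Set (ℤ × ℤ → Bool) :=
  {y | (∀ g h, latticeVal α g ≤ latticeVal α h → y h = true → y g = true) ∧
    y (0, 0) = true ∧ y (1, 0) = false}

lemma isCompact_unitCuts (α : ℝ) : IsCompact (unitCuts α) := by
  refine IsClosed.isCompact ?_
  have h1 (g h : ℤ × ℤ) : IsClosed {y : ℤ × ℤ → Bool |
      latticeVal α g ≤ latticeVal α h → y h = true → y g = true} := by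
    have : {y : ℤ × ℤ → Bool | latticeVal α g ≤ latticeVal α h → y h = true → y g = true} =
        (fun y : ℤ × ℤ → Bool => (y h, y g)) ⁻¹'
          {p | latticeVal α g ≤ latticeVal α h → p.1 = true → p.2 = true} := rfl
    rw [this]
    exact (isClosed_discrete _).preimage (by fun_prop)
  have h2 (g : ℤ × ℤ) (b : Bool) : IsClosed {y : ℤ × ℤ → Bool | y g = b} :=
    isClosed_eq (continuous_apply g) continuous_const
  simp only [unitCuts, ofPred_and, ofPred_forall]
  refine IsClosed.inter (isClosed_iInter fun g => isClosed_iInter fun h => ?_)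
    ((h2 _ _).inter (h2 _ _))
  simpa only [ofPred_forall] using h1 g h

/-- The inclusion of the unit interval of the cut line. -/
def unitCutsIncl (α : ℝ) (y : unitCuts α) : CutLine α :=
  ⟨y.1, y.2.1, ⟨_, y.2.2.1⟩, ⟨_, y.2.2.2⟩⟩

lemma continuous_unitCutsIncl (α : ℝ) : Continuous (unitCutsIncl α) :=
  continuous_subtype_val.subtype_mk _

lemma floor_unitCutsIncl {α : ℝ} (y : unitCuts α) : (unitCutsIncl α y).floor 0 = 0 := by
  have h1 := (unitCutsIncl α y).le_floor 0 0
  have h2 := (unitCutsIncl α y).le_floor 1 0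
  have h3 : (unitCutsIncl α y).1 (0, -0) = true := y.2.2.1
  have h4 : (unitCutsIncl α y).1 (1, -0) = false := y.2.2.2
  simp only [h3, h4, iff_true, Bool.false_eq_true, iff_false] at h1 h2
  omega

/-- The coding of cuts in the unit interval is bijective onto the Sturmian subshift. -/
lemma exists_homeomorph_unitCuts {α : ℝ} (hα : α ∈ Ioo (0 : ℝ) 1) :
    ∃ e : unitCuts α ≃ₜ sturmianZ α, ∀ y, (e y).1 = (unitCutsIncl α y).code := by
  have : CompactSpace (unitCuts α) := isCompact_iff_compactSpace.1 (isCompact_unitCuts α)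
  have hc : Continuous fun y => (unitCutsIncl α y).code :=
    CutLine.continuous_code.comp (continuous_unitCutsIncl α)
  let f : unitCuts α → sturmianZ α := fun y => ⟨(unitCutsIncl α y).code, CutLine.code_mem _⟩
  have hf : Continuous f := hc.subtype_mk _
  have hinj : Function.Injective f := by
    intro y z hyz
    have := CutLine.eq_of_code_eq hα (congrArg Subtype.val hyz)
      (by rw [floor_unitCutsIncl, floor_unitCutsIncl])
    exact Subtype.ext (congrArg (Subtype.val : CutLine α → _) this)
  have hsurj : Function.Surjective f := by
    have hsub : sturmianZ α ⊆ range fun y => (unitCutsIncl α y).code := by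
      refine closure_minimal ?_ (isCompact_range hc).isClosed
      rintro _ ⟨t, rfl⟩
      refine ⟨⟨(CutLine.ofReal α (Int.fract t)).1, (CutLine.ofReal α (Int.fract t)).2.1, ?_, ?_⟩, ?_⟩
      · simp [CutLine.ofReal, latticeVal, Int.fract_nonneg]
      · simp [CutLine.ofReal, latticeVal, Int.fract_lt_one]
      · change (CutLine.ofReal α (Int.fract t)).code = _
        rw [CutLine.code_ofReal, sturmianSeqZ_fract]
    rintro ⟨x, hx⟩
    obtain ⟨y, hy⟩ := hsub hx
    exact ⟨y, Subtype.ext hy⟩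
  exact ⟨hf.homeoOfEquivCompactToT2 (f := Equiv.ofBijective f ⟨hinj, hsurj⟩), fun y => rfl⟩

/-- The Sturmian subshift has a continuous section into the cut line. -/
lemma exists_section {α : ℝ} (hα : α ∈ Ioo (0 : ℝ) 1) :
    ∃ κ : sturmianZ α → CutLine α, Continuous κ ∧ ∀ x, (κ x).code = x.1 := by
  obtain ⟨e, he⟩ := exists_homeomorph_unitCuts hα
  exact ⟨fun x => unitCutsIncl α (e.symm x),
    (continuous_unitCutsIncl α).comp e.symm.continuous, fun x => by rw [← he]; simp⟩

lemma CutLine.exists_point {α : ℝ} (y : CutLine α) :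
    ∃ t : ℝ, (∀ g, y.1 g = true → latticeVal α g ≤ t) ∧ ∀ g, y.1 g = false → t ≤ latticeVal α g := by
  obtain ⟨hmono, ⟨g, hg⟩, ⟨h, hh⟩⟩ := y.2
  have hle : ∀ k k', y.1 k = true → y.1 k' = false → latticeVal α k ≤ latticeVal α k' := by
    intro k k' hk hk'
    by_contra! hlt
    simp [hmono k' k hlt.le hk] at hk'
  refine ⟨sSup (latticeVal α '' {g | y.1 g = true}), fun k hk => ?_, fun k hk => ?_⟩
  · exact le_csSup ⟨latticeVal α h, by rintro _ ⟨k, hk, rfl⟩; exact hle k h hk hh⟩ ⟨k, hk, rfl⟩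
  · exact csSup_le ⟨_, g, hg, rfl⟩ (by rintro _ ⟨l, hl, rfl⟩; exact hle l k hl hk)

/-- The real number at which a cut is placed. -/
def CutLine.point {α : ℝ} (y : CutLine α) : ℝ := y.exists_point.choose

lemma CutLine.le_point {α : ℝ} (y : CutLine α) {g : ℤ × ℤ} (h : y.1 g = true) :
    latticeVal α g ≤ y.point := y.exists_point.choose_spec.1 g h

lemma CutLine.point_le {α : ℝ} (y : CutLine α) {g : ℤ × ℤ} (h : y.1 g = false) :
    y.point ≤ latticeVal α g := y.exists_point.choose_spec.2 g h

lemma CutLine.point_eq {α : ℝ} (hα : Irrational α) (y : CutLine α) (t : ℝ)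
    (h₁ : ∀ g, y.1 g = true → latticeVal α g ≤ t) (h₂ : ∀ g, y.1 g = false → t ≤ latticeVal α g) :
    y.point = t := by
  rcases lt_trichotomy y.point t with h | h | h
  · obtain ⟨g, hg, hg'⟩ := exists_latticeVal_btwn hα h
    cases hy : y.1 g
    · linarith [h₂ g hy]
    · linarith [y.le_point hy]
  · exact h
  · obtain ⟨g, hg, hg'⟩ := exists_latticeVal_btwn hα h
    cases hy : y.1 g
    · linarith [y.point_le hy]
    · linarith [h₁ g hy]

lemma CutLine.continuous_point {α : ℝ} (hα : Irrational α) :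
    Continuous (CutLine.point (α := α)) := by
  refine Metric.continuous_iff'.2 fun y ε hε => ?_
  obtain ⟨g, hg, hg'⟩ := exists_latticeVal_btwn hα (sub_lt_self y.point hε)
  obtain ⟨h, hh, hh'⟩ := exists_latticeVal_btwn hα (lt_add_of_pos_right y.point hε)
  have hyg : y.1 g = true := by
    by_contra hc
    linarith [y.point_le (Bool.eq_false_iff.2 hc)]
  have hyh : y.1 h = false := by
    by_contra hc
    linarith [y.le_point (Bool.not_eq_false _ ▸ hc)]
  filter_upwards [(CutLine.continuous_apply g).continuousAt.eventually_mem
      ((isOpen_discrete {true}).mem_nhds hyg),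
    (CutLine.continuous_apply h).continuousAt.eventually_mem
      ((isOpen_discrete {false}).mem_nhds hyh)] with z hzg hzh
  rw [Real.dist_eq, abs_lt]
  constructor <;> linarith [z.le_point hzg, z.point_le hzh]

lemma CutLine.point_translate {α : ℝ} (hα : Irrational α) (y : CutLine α) (g : ℤ × ℤ) :
    (y.translate g).point = y.point + latticeVal α g := by
  refine CutLine.point_eq hα _ _ (fun h hh => ?_) fun h hh => ?_
  · linarith [latticeVal_sub α h g, y.le_point (g := h - g) hh]
  · linarith [latticeVal_sub α h g, y.point_le (g := h - g) hh]

/-! ### Equivalent irrationals give flow equivalent subshifts -/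

lemma suspension_mk_eq_of_shift {α : ℝ} {x x' : sturmianZ α} (n : ℤ)
    (h : ∀ i, x'.1 i = x.1 (i + n)) (s : ℝ) :
    (Quot.mk _ (x', s) : Suspension α) = Quot.mk _ (x, s + n) := by
  have key : ∀ (n : ℕ) (x x' : sturmianZ α) (s : ℝ), (∀ i, x'.1 i = x.1 (i + n)) →
      (Quot.mk _ (x', s) : Suspension α) = Quot.mk _ (x, s + n) := by
    intro n
    induction n with
    | zero =>
      intro x x' s h
      have : x' = x := Subtype.ext (funext fun i => by simpa using h i)
      rw [this]
      simp
    | succ n ih =>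
      intro x x' s h
      rw [ih (sturmianShiftZ α x) x' s fun i => ?_]
      · refine (Quot.sound ⟨x, s + n, ?_, rfl⟩).symm
        push_cast
        rw [add_assoc]
      · rw [h]
        change _ = x.1 (i + n + 1)
        push_cast
        rw [add_assoc]
  obtain ⟨k, rfl | rfl⟩ := n.eq_nat_or_neg
  · simpa using key k x x' s h
  · have := key k x' x (s - k) fun i => by rw [h]; simp
    rw [sub_add_cancel] at this
    rw [← this]
    push_cast
    rw [sub_eq_add_neg]

/-- The point of the suspension determined by a cut and a time. -/
def CutLine.suspend {α : ℝ} (y : CutLine α) (s : ℝ) : Suspension α :=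
  Quot.mk _ (⟨y.code, y.code_mem⟩, s)

lemma CutLine.suspend_translate {α : ℝ} (y : CutLine α) (g : ℤ × ℤ) (s : ℝ) :
    (y.translate g).suspend s = y.suspend (s + g.2) :=
  suspension_mk_eq_of_shift _ (y.code_translate g) s

lemma CutLine.continuous_suspend {α : ℝ} :
    Continuous fun p : CutLine α × ℝ => p.1.suspend p.2 :=
  continuous_quot_mk.comp
    (((CutLine.continuous_code.comp continuous_fst).subtype_mk _).prodMk continuous_snd)

lemma suspFlow_suspend {α : ℝ} (y : CutLine α) (s s' : ℝ) :
    suspFlow α s' (y.suspend s) = y.suspend (s + s') := rfl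

lemma exists_suspend_eq {α : ℝ} (hα : α ∈ Ioo (0 : ℝ) 1) (u : Suspension α) :
    ∃ (y : CutLine α) (s : ℝ), y.suspend s = u := by
  obtain ⟨κ, -, hκ⟩ := exists_section hα
  induction u using Quot.ind with
  | mk p => exact ⟨κ p.1, p.2, congrArg (Quot.mk _) (Prod.ext (Subtype.ext (hκ p.1)) rfl)⟩

/-- A continuous map on `CutLine α × ℝ` invariant under `ℤ × ℤ` descends to the suspension. -/
lemma exists_continuous_descent {α : ℝ} (hα : α ∈ Ioo (0 : ℝ) 1) {X : Type*} [TopologicalSpace X]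
    (G : CutLine α × ℝ → X) (hG : Continuous G)
    (hinv : ∀ y g s, G (y.translate g, s) = G (y, s + g.2)) :
    ∃ F : Suspension α → X, Continuous F ∧ ∀ y s, F (y.suspend s) = G (y, s) := by
  obtain ⟨κ, hκc, hκ⟩ := exists_section hα
  refine ⟨Quot.lift (fun p => G (κ p.1, p.2)) ?_, continuous_quot_lift _ (by fun_prop), ?_⟩
  · rintro _ _ ⟨x, s, rfl, rfl⟩
    have : ((κ x).translate (0, 1)).code = (κ (sturmianShiftZ α x)).code := by
      funext i
      rw [CutLine.code_translate, hκ, hκ]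
      rfl
    obtain ⟨m, hm⟩ := CutLine.exists_translate_of_code_eq hα this
    simp only
    rw [hm, hinv, hinv]
    simp
  · intro y s
    have : (κ ⟨y.code, y.code_mem⟩).code = y.code := hκ _
    obtain ⟨m, hm⟩ := CutLine.exists_translate_of_code_eq hα this
    change G (κ ⟨y.code, y.code_mem⟩, s) = _
    conv_rhs => rw [hm, hinv]
    simp

/-- The hypothesis that `β = (a α + b) / (c α + d)`, where `a d - b c = δ = ±1` is the sign
of `c α + d`. -/
structure IsMoebius (α β : ℝ) (a b c d δ : ℤ) : Prop where
  sq : δ * δ = 1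
  det : a * d - b * c = δ
  pos : 0 < δ * (c * α + d)
  eq : β * (c * α + d) = a * α + b

lemma IrrationalEquiv.exists_isMoebius {α β : ℝ} (hα : Irrational α) (h : IrrationalEquiv α β) :
    ∃ a b c d δ : ℤ, IsMoebius α β a b c d δ := by
  obtain ⟨a, b, c, d, hdet, hβ⟩ := h
  have hne : (c : ℝ) * α + d ≠ 0 := by
    intro h0
    rcases eq_or_ne c 0 with rfl | hc
    · have : d = 0 := by simpa using h0
      simp [this] at hdet
    · exact ((hα.intCast_mul hc).add_intCast d).ne_zero h0
  have hβ' : β * (c * α + d) = a * α + b := by rw [hβ, div_mul_cancel₀ _ hne]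
  have hsq : (a * d - b * c) * (a * d - b * c) = 1 := by rcases hdet with h | h <;> simp [h]
  have hδ : ((a * d - b * c : ℤ) : ℝ) ≠ 0 := by
    intro h0
    have : a * d - b * c = 0 := by exact_mod_cast h0
    simp [this] at hsq
  rcases lt_or_gt_of_ne (mul_ne_zero hδ hne) with hlt | hgt
  · refine ⟨-a, -b, -c, -d, a * d - b * c, hsq, by ring, ?_, ?_⟩
    · push_cast at hlt ⊢; linarith
    · push_cast; linarith
  · exact ⟨a, b, c, d, a * d - b * c, hsq, rfl, hgt, hβ'⟩

namespace IsMoebius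

variable {α β : ℝ} {a b c d δ : ℤ}

lemma sq_real (h : IsMoebius α β a b c d δ) : (δ : ℝ) * δ = 1 := by exact_mod_cast h.sq

lemma det_real (h : IsMoebius α β a b c d δ) : (a : ℝ) * d - b * c = δ := by
  exact_mod_cast h.det

lemma inv_mul (h : IsMoebius α β a b c d δ) :
    (((-δ * c : ℤ) : ℝ) * β + (δ * a : ℤ)) * (c * α + d) = 1 := by
  have h1 := h.sq_real
  have h2 := h.det_real
  push_cast
  linear_combination (-δ * c : ℝ) * h.eq + δ * h2 + h1

lemma symm (h : IsMoebius α β a b c d δ) :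
    IsMoebius β α (δ * d) (-δ * b) (-δ * c) (δ * a) δ := by
  have h2 := h.det
  have h2' := h.det_real
  have h3 := h.eq
  have hp := h.pos
  have hsq := h.sq
  have hi := h.inv_mul
  have hne : (c * α + d : ℝ) ≠ 0 := fun h0 => by simp [h0] at hp
  refine ⟨h.sq, ?_, ?_, ?_⟩
  · linear_combination (δ * δ) * h2 + δ * hsq
  · have : (((-δ * c : ℤ) : ℝ) * β + (δ * a : ℤ)) = (δ * δ) / (c * α + d) := by
      rw [h.sq_real, eq_div_iff hne, hi]
    rw [this, ← mul_div_assoc]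
    have h5 : (0 : ℝ) < (c * α + d) * (c * α + d) := mul_self_pos.2 hne
    have h6 : (δ : ℝ) * (δ * δ) / (c * α + d) = δ * (c * α + d) / ((c * α + d) * (c * α + d)) := by
      rw [h.sq_real]
      field_simp
    rw [h6]
    positivity
  · refine mul_right_cancel₀ hne ?_
    rw [mul_assoc, hi]
    push_cast
    linear_combination (-δ * d : ℝ) * h3 - α * δ * h2' - α * h.sq_real

/-- The induced map of the cut lines. -/
lemma exists_cutLine_map (h : IsMoebius α β a b c d δ) :
    ∃ S : CutLine α → CutLine β, ∀ y g, (S y).1 g =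
      (y.1 (d * g.1 + b * g.2, c * g.1 + a * g.2) ^^ decide (δ = -1)) := by
  have hv : ∀ g : ℤ × ℤ, latticeVal α (d * g.1 + b * g.2, c * g.1 + a * g.2) =
      (c * α + d) * latticeVal β g := by
    intro g
    simp only [latticeVal]
    push_cast
    linear_combination -(g.2 : ℝ) * h.eq
  have hsurj : ∀ g : ℤ × ℤ, ∃ k : ℤ × ℤ, (d * k.1 + b * k.2, c * k.1 + a * k.2) = g := by
    intro g
    refine ⟨(δ * (a * g.1 - b * g.2), δ * (-c * g.1 + d * g.2)), Prod.ext ?_ ?_⟩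
    · linear_combination g.1 * δ * h.det + g.1 * h.sq
    · linear_combination g.2 * δ * h.det + g.2 * h.sq
  have hpos := h.pos
  rcases mul_self_eq_one_iff.1 h.sq with rfl | rfl
  · simp only [Int.cast_one, one_mul] at hpos
    refine ⟨fun y => ⟨fun g => y.1 (d * g.1 + b * g.2, c * g.1 + a * g.2), ?_, ?_, ?_⟩,
      fun y g => by simp⟩
    · intro g k hgk hk
      refine y.2.1 _ _ ?_ hk
      rw [hv, hv]
      gcongr
    · obtain ⟨g, hg⟩ := y.2.2.1
      obtain ⟨k, rfl⟩ := hsurj g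
      exact ⟨k, hg⟩
    · obtain ⟨g, hg⟩ := y.2.2.2
      obtain ⟨k, rfl⟩ := hsurj g
      exact ⟨k, hg⟩
  · simp only [Int.cast_neg, Int.cast_one, neg_mul, one_mul] at hpos
    refine ⟨fun y => ⟨fun g => !y.1 (d * g.1 + b * g.2, c * g.1 + a * g.2), ?_, ?_, ?_⟩,
      fun y g => by simp⟩
    · intro g k hgk hk
      simp only [Bool.not_eq_true', ← Bool.not_eq_true] at hk ⊢
      refine fun hg => hk (y.2.1 _ _ ?_ hg)
      rw [hv, hv]
      nlinarith
    · obtain ⟨g, hg⟩ := y.2.2.2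
      obtain ⟨k, rfl⟩ := hsurj g
      exact ⟨k, by simp [hg]⟩
    · obtain ⟨g, hg⟩ := y.2.2.1
      obtain ⟨k, rfl⟩ := hsurj g
      exact ⟨k, by simp [hg]⟩

/-- The map of cut lines induced by a Möbius transformation. -/
def cutMap (h : IsMoebius α β a b c d δ) : CutLine α → CutLine β := h.exists_cutLine_map.choose

lemma cutMap_apply (h : IsMoebius α β a b c d δ) (y : CutLine α) (g : ℤ × ℤ) :
    (h.cutMap y).1 g = (y.1 (d * g.1 + b * g.2, c * g.1 + a * g.2) ^^ decide (δ = -1)) :=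
  h.exists_cutLine_map.choose_spec y g

lemma continuous_cutMap (h : IsMoebius α β a b c d δ) : Continuous h.cutMap := by
  refine continuous_induced_rng.2 (continuous_pi fun g => ?_)
  have : (fun y : CutLine α => (Subtype.val ∘ h.cutMap) y g) = fun y =>
      (y.1 (d * g.1 + b * g.2, c * g.1 + a * g.2) ^^ decide (δ = -1)) :=
    funext fun y => h.cutMap_apply y g
  rw [this]
  exact (continuous_of_discreteTopology (f := fun v : Bool => (v ^^ decide (δ = -1)))).comp
    (CutLine.continuous_apply _)

lemma cutMap_translate (h : IsMoebius α β a b c d δ) (y : CutLine α) (g : ℤ × ℤ) :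
    h.cutMap (y.translate g) =
      (h.cutMap y).translate (δ * (a * g.1 - b * g.2), δ * (-c * g.1 + d * g.2)) := by
  refine Subtype.ext (funext fun k => ?_)
  simp only [CutLine.translate, h.cutMap_apply, Prod.fst_sub, Prod.snd_sub]
  congr 1
  refine congrArg y.1 (Prod.ext ?_ ?_) <;> simp only [Prod.fst_sub, Prod.snd_sub]
  · linear_combination g.1 * δ * h.det + g.1 * h.sq
  · linear_combination g.2 * δ * h.det + g.2 * h.sq

lemma symm_cutMap_cutMap (h : IsMoebius α β a b c d δ) (y : CutLine α) :
    h.symm.cutMap (h.cutMap y) = y := by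
  refine Subtype.ext (funext fun g => ?_)
  simp only [h.symm.cutMap_apply, h.cutMap_apply]
  rw [Bool.xor_assoc, Bool.xor_self, Bool.xor_false]
  refine congrArg y.1 (Prod.ext ?_ ?_) <;> dsimp only
  · linear_combination g.1 * δ * h.det + g.1 * h.sq
  · linear_combination g.2 * δ * h.det + g.2 * h.sq

lemma point_cutMap (h : IsMoebius α β a b c d δ) (hβ : Irrational β) (y : CutLine α) :
    (h.cutMap y).point * (c * α + d) = y.point := by
  have hv : ∀ g : ℤ × ℤ, latticeVal α (d * g.1 + b * g.2, c * g.1 + a * g.2) =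
      latticeVal β g * (c * α + d) := by
    intro g
    simp only [latticeVal]
    push_cast
    linear_combination -(g.2 : ℝ) * h.eq
  have hpos := h.pos
  have key := fun g => h.cutMap_apply y g
  have hne : (c * α + d : ℝ) ≠ 0 := fun h0 => by simp [h0] at hpos
  rw [← eq_div_iff hne]
  rcases mul_self_eq_one_iff.1 h.sq with rfl | rfl
  · simp only [Int.cast_one, one_mul] at hpos
    refine CutLine.point_eq hβ _ _ (fun g hg => ?_) fun g hg => ?_
    · rw [key] at hg
      rw [le_div_iff₀ hpos, ← hv]
      exact y.le_point (by simpa using hg)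
    · rw [key] at hg
      rw [div_le_iff₀ hpos, ← hv]
      exact y.point_le (by simpa using hg)
  · simp only [Int.cast_neg, Int.cast_one, neg_mul, one_mul, neg_pos] at hpos
    refine CutLine.point_eq hβ _ _ (fun g hg => ?_) fun g hg => ?_
    · rw [key] at hg
      rw [le_div_iff_of_neg hpos, ← hv]
      exact y.point_le (by simpa using hg)
    · rw [key] at hg
      rw [div_le_iff_of_neg hpos, ← hv]
      exact y.le_point (by simpa using hg)

lemma exists_suspension_map (h : IsMoebius α β a b c d δ) (hα : Irrational α)
    (hαm : α ∈ Ioo (0 : ℝ) 1) :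
    ∃ f : Suspension α → Suspension β, Continuous f ∧ ∀ y s,
      f (y.suspend s) = (h.cutMap y).suspend (δ * (c * y.point + (c * α + d) * s)) := by
  refine exists_continuous_descent hαm (fun p => (h.cutMap p.1).suspend
    (δ * (c * p.1.point + (c * α + d) * p.2))) ?_ ?_
  · have := CutLine.continuous_point hα
    exact CutLine.continuous_suspend.comp
      ((h.continuous_cutMap.comp continuous_fst).prodMk (by fun_prop))
  · intro y g s
    simp only
    rw [h.cutMap_translate, CutLine.suspend_translate, CutLine.point_translate hα, latticeVal]
    congr 1
    push_cast
    ring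

end IsMoebius

lemma sturmianFlowEquiv_of_irrationalEquiv {α β : ℝ} (hα : Irrational α) (hβ : Irrational β)
    (hαm : α ∈ Ioo (0 : ℝ) 1) (hβm : β ∈ Ioo (0 : ℝ) 1) (h : IrrationalEquiv α β) :
    SturmianFlowEquiv α β := by
  obtain ⟨a, b, c, d, δ, h⟩ := h.exists_isMoebius hα
  have key : ∀ {α β : ℝ} {a b c d δ : ℤ} (h : IsMoebius α β a b c d δ) (_ : Irrational β)
      (y : CutLine α) (s : ℝ), (h.symm.cutMap (h.cutMap y)).suspend
        (δ * ((-δ * c : ℤ) * (h.cutMap y).point + ((-δ * c : ℤ) * β + (δ * a : ℤ)) *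
          (δ * (c * y.point + (c * α + d) * s)))) = y.suspend s := by
    intro α β a b c d δ h hβ y s
    rw [h.symm_cutMap_cutMap]
    congr 1
    rw [← h.point_cutMap hβ y]
    have h1 := h.inv_mul
    have h2 := h.sq_real
    push_cast at h1 ⊢
    linear_combination (δ * δ * c * (h.cutMap y).point + δ * δ * s) * h1 + s * h2
  obtain ⟨f, hf, hf'⟩ := h.exists_suspension_map hα hαm
  obtain ⟨f₁, hf₁, hf₁'⟩ := h.symm.exists_suspension_map hβ hβm
  obtain ⟨f₂, -, hf₂'⟩ := h.symm.symm.exists_suspension_map hα hαm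
  have hinj : Function.Injective f₁ := by
    refine Function.LeftInverse.injective (g := f₂) fun u => ?_
    obtain ⟨y, s, rfl⟩ := exists_suspend_eq hβm u
    rw [hf₁', hf₂', key h.symm hα]
  have hleft : ∀ u, f₁ (f u) = u := by
    intro u
    obtain ⟨y, s, rfl⟩ := exists_suspend_eq hαm u
    rw [hf', hf₁', key h hβ]
  refine ⟨⟨⟨f, f₁, hleft, fun u => hinj (hleft _)⟩, hf, hf₁⟩, fun u => ?_⟩
  obtain ⟨y, s, rfl⟩ := exists_suspend_eq hαm u
  refine ⟨fun t => δ * (c * α + d) * t, fun t t' ht => mul_lt_mul_of_pos_left ht h.pos,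
    mul_left_surjective₀ h.pos.ne', fun t => ?_⟩
  change f _ = suspFlow β _ (f _)
  rw [suspFlow_suspend, hf', hf', suspFlow_suspend]
  congr 1
  ring

/-! ### Birkhoff sums of continuous integer functions -/

/-- The Birkhoff sums of `K` under the rotation by `α` stay within bounded distance of those of
the constant `w`. -/
def HasBoundedDiscrepancy (α : ℝ) (K : ℝ → ℝ) (w : ℝ) : Prop :=
  ∃ C : ℝ, ∀ (t : ℝ) (n : ℕ), |∑ i ∈ Finset.range n, K (t + i * α) - n * w| ≤ C

lemma HasBoundedDiscrepancy.const (α a : ℝ) : HasBoundedDiscrepancy α (fun _ => a) a :=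
  ⟨0, fun t n => by simp⟩

lemma HasBoundedDiscrepancy.add {α : ℝ} {K L : ℝ → ℝ} {v w : ℝ}
    (hK : HasBoundedDiscrepancy α K v) (hL : HasBoundedDiscrepancy α L w) :
    HasBoundedDiscrepancy α (fun t => K t + L t) (v + w) := by
  obtain ⟨C, hC⟩ := hK
  obtain ⟨D, hD⟩ := hL
  refine ⟨C + D, fun t n => ?_⟩
  rw [Finset.sum_add_distrib]
  refine le_trans (le_of_eq ?_) ((abs_add_le _ _).trans (add_le_add (hC t n) (hD t n)))
  congr 1
  ring

lemma HasBoundedDiscrepancy.const_mul {α : ℝ} {K : ℝ → ℝ} {w : ℝ}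
    (hK : HasBoundedDiscrepancy α K w) (a : ℝ) :
    HasBoundedDiscrepancy α (fun t => a * K t) (a * w) := by
  obtain ⟨C, hC⟩ := hK
  refine ⟨|a| * C, fun t n => ?_⟩
  have : ∑ i ∈ Finset.range n, a * K (t + i * α) - n * (a * w) =
      a * (∑ i ∈ Finset.range n, K (t + i * α) - n * w) := by
    rw [← Finset.mul_sum]; ring
  rw [this, abs_mul]
  exact mul_le_mul_of_nonneg_left (hC t n) (abs_nonneg a)

lemma HasBoundedDiscrepancy.sum {α : ℝ} {ι : Type*} (S : Finset ι) {K : ι → ℝ → ℝ} {w : ι → ℝ}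
    (h : ∀ i ∈ S, HasBoundedDiscrepancy α (K i) (w i)) :
    HasBoundedDiscrepancy α (fun t => ∑ i ∈ S, K i t) (∑ i ∈ S, w i) := by
  classical
  induction S using Finset.induction_on with
  | empty => simpa using HasBoundedDiscrepancy.const α 0
  | insert i S hi ih =>
    simp only [Finset.sum_insert hi]
    exact (h i (Finset.mem_insert_self i S)).add
      (ih fun j hj => h j (Finset.mem_insert_of_mem hj))

lemma HasBoundedDiscrepancy.fract_sub_fract (α : ℝ) (n : ℤ) :
    HasBoundedDiscrepancy α (fun t => Int.fract t - Int.fract (t - n * α)) 0 := by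
  have step (s : ℝ) :
      HasBoundedDiscrepancy α (fun t => Int.fract (t - s) - Int.fract (t - s - α)) 0 := by
    refine ⟨1, fun t n => ?_⟩
    have := Finset.sum_range_sub (fun i : ℕ => Int.fract (t - s - α + i * α)) n
    have e : ∑ i ∈ Finset.range n, (Int.fract (t + i * α - s) - Int.fract (t + i * α - s - α)) =
        Int.fract (t - s - α + n * α) - Int.fract (t - s - α) := by
      rw [Nat.cast_zero, zero_mul, add_zero] at this
      rw [← this]
      refine Finset.sum_congr rfl fun i _ => ?_
      congr 2 <;> push_cast <;> ring
    rw [e, mul_zero, sub_zero, abs_le]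
    have h1 := Int.fract_nonneg (t - s - α + n * α)
    have h2 := Int.fract_lt_one (t - s - α + n * α)
    have h3 := Int.fract_nonneg (t - s - α)
    have h4 := Int.fract_lt_one (t - s - α)
    constructor <;> linarith
  induction n using Int.induction_on with
  | zero => simpa using HasBoundedDiscrepancy.const α 0
  | succ n ih =>
    have := ih.add (step (n * α))
    rw [add_zero] at this
    convert this using 2 with t
    push_cast
    rw [show t - (n + 1) * α = t - n * α - α by ring]
    ring
  | pred n ih =>
    have := ih.add ((step (-(n + 1) * α)).const_mul (-1))
    rw [mul_zero, add_zero] at this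
    convert this using 2 with t
    push_cast
    rw [show t - (-n - 1) * α = t - -(n + 1) * α by ring,
      show t - -(n + 1) * α - α = t - -n * α by ring]
    ring

lemma ite_le_fract_eq {γ : ℝ} (h0 : 0 ≤ γ) (h1 : γ ≤ 1) (t : ℝ) :
    (if γ ≤ Int.fract t then (1 : ℝ) else 0) = 1 - γ + (Int.fract t - Int.fract (t - γ)) := by
  have ht := Int.floor_add_fract t
  have hn := Int.fract_nonneg t
  have hl := Int.fract_lt_one t
  split_ifs with h
  · have : ⌊t - γ⌋ = ⌊t⌋ := Int.floor_eq_iff.2 ⟨by linarith, by linarith⟩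
    rw [← Int.self_sub_floor (t - γ), this]
    linarith
  · have : ⌊t - γ⌋ = ⌊t⌋ - 1 :=
      Int.floor_eq_iff.2 ⟨by push_cast; linarith, by push_cast; linarith⟩
    rw [← Int.self_sub_floor (t - γ), this]
    push_cast
    linarith

lemma latticeVal_mem (α : ℝ) (g : ℤ × ℤ) : latticeVal α g ∈ ZplusAZ α := ⟨g.1, g.2, rfl⟩

lemma exists_discrepancy_ite (α : ℝ) (g : ℤ × ℤ) :
    ∃ w ∈ ZplusAZ α, HasBoundedDiscrepancy α
      (fun t => if latticeVal α g ≤ Int.fract t then (1 : ℝ) else 0) w := by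
  rcases lt_or_ge (latticeVal α g) 0 with h0 | h0
  · refine ⟨1, one_mem_ZplusAZ α, ?_⟩
    simpa [fun t : ℝ => h0.le.trans (Int.fract_nonneg t)] using HasBoundedDiscrepancy.const α 1
  rcases lt_or_ge 1 (latticeVal α g) with h1 | h1
  · refine ⟨0, zero_mem _, ?_⟩
    simpa [fun t : ℝ => ((Int.fract_lt_one t).trans h1).not_ge] using
      HasBoundedDiscrepancy.const α 0
  refine ⟨1 - latticeVal α g, sub_mem (one_mem_ZplusAZ α) (latticeVal_mem α g), ?_⟩
  have := (HasBoundedDiscrepancy.const α (1 - latticeVal α g)).add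
    (HasBoundedDiscrepancy.fract_sub_fract α g.2)
  rw [add_zero] at this
  convert this using 2 with t
  rw [ite_le_fract_eq h0 h1]
  congr 2
  rw [latticeVal, ← sub_sub, sub_right_comm, Int.fract_sub_intCast]

/-- A function on the line depending only on the position relative to finitely many points is a
combination of indicator functions of half-lines. -/
lemma exists_eq_sum_ite (S : Finset ℝ) (f : ℝ → ℤ)
    (hf : ∀ t t', (∀ γ ∈ S, γ ≤ t ↔ γ ≤ t') → f t = f t') :
    ∃ (c : ℤ) (a : ℝ → ℤ), ∀ t, f t = c + ∑ γ ∈ S, a γ * if γ ≤ t then 1 else 0 := by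
  induction S using Finset.induction_on_max generalizing f with
  | empty => exact ⟨f 0, 0, fun t => by simpa using hf t 0 (by simp)⟩
  | insert γ S hγ ih =>
    obtain ⟨m, hmγ, hm⟩ : ∃ m < γ, ∀ x ∈ S, x ≤ m := by
      rcases S.eq_empty_or_nonempty with rfl | hS
      · exact ⟨γ - 1, by linarith, by simp⟩
      · exact ⟨S.max' hS, hγ _ (S.max'_mem hS), fun x hx => S.le_max' x hx⟩
    obtain ⟨c, a, ha⟩ := ih (fun t => f (if t < γ then t else m)) fun t t' htt' => hf _ _ fun x hx => by
      rcases Finset.mem_insert.1 hx with rfl | hx'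
      · have h1 : ∀ t, ¬ x ≤ if t < x then t else m := by
          intro t; split_ifs <;> linarith
        simp only [h1]
      · have h1 : ∀ t, (x ≤ if t < γ then t else m) ↔ x ≤ t := by
          intro t
          split_ifs with h
          · rfl
          · exact ⟨fun _ => (hγ x hx').le.trans (not_lt.1 h), fun _ => hm x hx'⟩
        rw [h1, h1, htt' x hx']
    have hγS : γ ∉ S := fun h => lt_irrefl _ (hγ γ h)
    refine ⟨c, Function.update a γ (f γ - f m), fun t => ?_⟩
    rw [Finset.sum_insert hγS, Function.update_self]
    have : ∑ x ∈ S, Function.update a γ (f γ - f m) x * (if x ≤ t then 1 else 0) =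
        ∑ x ∈ S, a x * if x ≤ t then 1 else 0 :=
      Finset.sum_congr rfl fun x hx => by
        rw [Function.update_of_ne (ne_of_mem_of_not_mem hx hγS)]
    rw [this]
    have := ha t
    rcases lt_or_ge t γ with h | h
    · rw [if_pos h] at this
      rw [if_neg h.not_ge, this]
      ring
    · rw [if_neg h.not_gt] at this
      rw [if_pos h, hf t γ fun x hx => ?_]
      · linarith
      · rcases Finset.mem_insert.1 hx with rfl | hx'
        · simpa using h
        · exact ⟨fun _ => (hγ x hx').le, fun _ => (hγ x hx').le.trans h⟩

/-- A continuous function on a compact set of Boolean sequences with values in a discrete space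
depends on finitely many coordinates. -/
lemma exists_finset_dependence {ι E : Type*} [TopologicalSpace E] [DiscreteTopology E]
    {X : Set (ι → Bool)} (hX : IsCompact X) (f : X → E) (hf : Continuous f) :
    ∃ S : Finset ι, ∀ x y : X, (∀ i ∈ S, x.1 i = y.1 i) → f x = f y := by
  classical
  have : CompactSpace X := isCompact_iff_compactSpace.1 hX
  have hloc : ∀ x : X, ∃ S : Finset ι, ∀ y : X, (∀ i ∈ S, y.1 i = x.1 i) → f y = f x := by
    intro x
    obtain ⟨U, hU, hUx⟩ := isOpen_induced_iff.1 ((isOpen_discrete {f x}).preimage hf)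
    have hxU : x.1 ∈ U := by
      have : x ∈ Subtype.val ⁻¹' U := hUx ▸ mem_singleton _
      exact this
    obtain ⟨S, u, hu, hS⟩ := isOpen_pi_iff.1 hU _ hxU
    refine ⟨S, fun y hy => ?_⟩
    have : y ∈ Subtype.val ⁻¹' U := hS fun i hi => by rw [hy i hi]; exact (hu i hi).2
    rw [hUx] at this
    exact this
  choose S hS using hloc
  have hopen (x : X) : {y : X | ∀ i ∈ S x, y.1 i = x.1 i} ∈ nhds x := by
    refine (Filter.eventually_all_finset _).2 fun i _ => ?_
    exact ((continuous_apply i).comp continuous_subtype_val).continuousAt.eventually_mem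
      ((isOpen_discrete {x.1 i}).mem_nhds rfl)
  obtain ⟨T, -, hT⟩ := isCompact_univ.elim_nhds_subcover _ fun x _ => hopen x
  refine ⟨T.biUnion S, fun x y hxy => ?_⟩
  obtain ⟨z, hz, hxz⟩ := mem_iUnion₂.1 (hT (mem_univ x))
  rw [hS z x hxz, hS z y fun i hi => ?_]
  rw [← hxz i hi, hxy i (Finset.mem_biUnion.2 ⟨z, hz, hi⟩)]

/-- The Sturmian sequences as points of the subshift. -/
def sturmianPoint (α t : ℝ) : sturmianZ α := ⟨sturmianSeqZ α t, subset_closure ⟨t, rfl⟩⟩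

lemma denseRange_sturmianPoint (α : ℝ) : DenseRange (sturmianPoint α) := by
  intro x
  rw [closure_subtype]
  refine closure_mono ?_ x.2
  rintro _ ⟨t, rfl⟩
  exact ⟨_, ⟨t, rfl⟩, rfl⟩

lemma sturmianShiftZ_sturmianPoint (α t : ℝ) :
    sturmianShiftZ α (sturmianPoint α t) = sturmianPoint α (t + α) := by
  refine Subtype.ext (funext fun i => ?_)
  change sturmianCode α (t + (i + 1 : ℤ) * α) = sturmianCode α (t + α + i * α)
  congr 1
  push_cast
  ring

lemma sturmianShiftZ_iterate_sturmianPoint (α t : ℝ) (n : ℕ) :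
    (sturmianShiftZ α)^[n] (sturmianPoint α t) = sturmianPoint α (t + n * α) := by
  induction n with
  | zero => simp
  | succ n ih =>
    rw [Function.iterate_succ_apply', ih, sturmianShiftZ_sturmianPoint]
    push_cast
    congr 1
    ring

lemma sturmianPoint_fract (α t : ℝ) : sturmianPoint α (Int.fract t) = sturmianPoint α t :=
  Subtype.ext (sturmianSeqZ_fract α t)

lemma continuous_sturmianShiftZ (α : ℝ) : Continuous (sturmianShiftZ α) :=
  (continuous_shiftZ.comp continuous_subtype_val).subtype_mk _

/-- Continuous integer functions on a Sturmian subshift have bounded discrepancy, with mean value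
in `ℤ + αℤ`. -/
lemma exists_mean_mem {α : ℝ} (hα : α ∈ Ioo (0 : ℝ) 1) (k : sturmianZ α → ℤ) (hk : Continuous k) :
    ∃ w ∈ ZplusAZ α, ∃ C : ℝ, ∀ (x : sturmianZ α) (n : ℕ),
      |∑ i ∈ Finset.range n, (k ((sturmianShiftZ α)^[i] x) : ℝ) - n * w| ≤ C := by
  obtain ⟨e, he⟩ := exists_homeomorph_unitCuts hα
  obtain ⟨S, hS⟩ := exists_finset_dependence (isCompact_unitCuts α) (k ∘ e) (hk.comp e.continuous)
  classical
  let T : Finset ℝ := (insert (0, 0) (insert (1, 0) S)).image (latticeVal α)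
  have hkey : ∀ t ∈ Ico (0 : ℝ) 1, ∀ t' ∈ Ico (0 : ℝ) 1, (∀ γ ∈ T, γ ≤ t ↔ γ ≤ t') →
      k (sturmianPoint α t) = k (sturmianPoint α t') := by
    have hmem : ∀ t ∈ Ico (0 : ℝ) 1, (CutLine.ofReal α t).1 ∈ unitCuts α := fun t ht =>
      ⟨(CutLine.ofReal α t).2.1, by simpa [CutLine.ofReal, latticeVal] using ht.1,
        by simpa [CutLine.ofReal, latticeVal] using ht.2⟩
    have he' : ∀ t (ht : t ∈ Ico (0 : ℝ) 1), e ⟨_, hmem t ht⟩ = sturmianPoint α t := fun t ht =>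
      Subtype.ext ((he _).trans (CutLine.code_ofReal α t))
    intro t ht t' ht' htt'
    rw [← he' t ht, ← he' t' ht']
    refine hS _ _ fun g hg => ?_
    change decide _ = decide _
    rw [decide_eq_decide]
    exact htt' _ (Finset.mem_image_of_mem _ (by simp [hg]))
  have h0 : (0 : ℝ) ∈ T := Finset.mem_image.2 ⟨(0, 0), by simp, by simp [latticeVal]⟩
  have h1 : (1 : ℝ) ∈ T := Finset.mem_image.2 ⟨(1, 0), by simp, by simp [latticeVal]⟩
  obtain ⟨c, a, ha⟩ := exists_eq_sum_ite T
    (fun t => if t ∈ Ico (0 : ℝ) 1 then k (sturmianPoint α t) else 0) fun t t' htt' => by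
      have hiff : t ∈ Ico (0 : ℝ) 1 ↔ t' ∈ Ico (0 : ℝ) 1 := by
        rw [mem_Ico, mem_Ico, htt' 0 h0, ← not_le, ← not_le, htt' 1 h1]
      by_cases ht : t ∈ Ico (0 : ℝ) 1
      · rw [if_pos ht, if_pos (hiff.1 ht)]
        exact hkey t ht t' (hiff.1 ht) htt'
      · rw [if_neg ht, if_neg fun h => ht (hiff.2 h)]
  have hT : ∀ γ : ℝ, ∃ w ∈ ZplusAZ α, γ ∈ T → HasBoundedDiscrepancy α
      (fun t => if γ ≤ Int.fract t then (1 : ℝ) else 0) w := by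
    intro γ
    by_cases hγ : γ ∈ T
    · obtain ⟨g, -, rfl⟩ := Finset.mem_image.1 hγ
      obtain ⟨w, hw, hw'⟩ := exists_discrepancy_ite α g
      exact ⟨w, hw, fun _ => hw'⟩
    · exact ⟨0, zero_mem _, fun h => absurd h hγ⟩
  choose w hw hw' using hT
  have hdisc := (HasBoundedDiscrepancy.const α c).add
    (HasBoundedDiscrepancy.sum T fun γ hγ => (hw' γ hγ).const_mul (a γ))
  have hcast : ∀ (z : ℤ) {r : ℝ}, r ∈ ZplusAZ α → (z : ℝ) * r ∈ ZplusAZ α := fun z r hr => by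
    rw [← zsmul_eq_mul]; exact zsmul_mem hr z
  refine ⟨c + ∑ γ ∈ T, a γ * w γ, add_mem (by simpa using hcast c (one_mem_ZplusAZ α))
    (sum_mem fun γ _ => hcast (a γ) (hw γ)), ?_⟩
  obtain ⟨C, hC⟩ := hdisc
  refine ⟨C, fun x n => ?_⟩
  refine (denseRange_sturmianPoint α).induction_on 
    (p := fun x => |∑ i ∈ Finset.range n, (k ((sturmianShiftZ α)^[i] x) : ℝ) -
      n * (c + ∑ γ ∈ T, a γ * w γ)| ≤ C) x ?_ fun t => ?_
  · refine isClosed_le (continuous_abs.comp ((continuous_finsetSum _ fun i _ => ?_).sub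
      continuous_const)) continuous_const
    exact (continuous_of_discreteTopology (f := fun z : ℤ => (z : ℝ))).comp
      (hk.comp ((continuous_sturmianShiftZ α).iterate i))
  · convert hC t n using 4 with i
    rw [sturmianShiftZ_iterate_sturmianPoint, ← sturmianPoint_fract]
    have := ha (Int.fract (t + i * α))
    rw [if_pos ⟨Int.fract_nonneg _, Int.fract_lt_one _⟩] at this
    rw [this]
    push_cast
    rfl

/-! ### Winding numbers along the flow -/

lemma exists_real_lift_of_totallyDisconnected {K : Type*} [TopologicalSpace K] [CompactSpace K]
    [T2Space K] [TotallyDisconnectedSpace K] (F : K → AddCircle (1 : ℝ)) (hF : Continuous F) :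
    ∃ θ : K → ℝ, Continuous θ ∧ ∀ x, (θ x : AddCircle (1 : ℝ)) = F x := by
  have hne : (0 : AddCircle (1 : ℝ)) ≠ ((1 / 2 : ℝ) : AddCircle (1 : ℝ)) := by
    rw [← AddCircle.coe_zero, Ne, AddCircle.coe_eq_coe_iff_of_mem_Ico (a := 0)] <;> norm_num
  obtain ⟨C, hC, h0, h2⟩ := exists_clopen_of_closed_subset_open
    (isClosed_singleton (x := (0 : AddCircle (1 : ℝ))).preimage hF)
    (isOpen_compl_singleton (x := ((1 / 2 : ℝ) : AddCircle (1 : ℝ))).preimage hF)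
    fun x hx => by
      rw [mem_preimage, mem_singleton_iff] at hx
      simpa [hx] using hne
  classical
  refine ⟨fun x => if x ∈ C then (AddCircle.equivIco 1 (1 / 2) (F x) : ℝ)
    else (AddCircle.equivIco 1 0 (F x) : ℝ), ?_, fun x => ?_⟩
  · refine continuous_if (by simp [hC.frontier_eq]) ?_ ?_
    · refine fun x hx => ContinuousAt.continuousWithinAt ?_
      change x ∈ closure C at hx
      rw [hC.isClosed.closure_eq] at hx
      exact continuous_subtype_val.continuousAt.comp
        (ContinuousAt.comp (AddCircle.continuousAt_equivIco 1 (1 / 2) (h2 hx)) hF.continuousAt)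
    · refine fun x hx => ContinuousAt.continuousWithinAt ?_
      change x ∈ closure Cᶜ at hx
      rw [hC.compl.isClosed.closure_eq] at hx
      exact continuous_subtype_val.continuousAt.comp
        (ContinuousAt.comp (AddCircle.continuousAt_equivIco 1 0 fun h => hx (h0 h))
          hF.continuousAt)
  · dsimp only
    split_ifs <;> exact AddCircle.coe_equivIco

instance (α : ℝ) : CompactSpace (sturmianZ α) :=
  isCompact_iff_compactSpace.1 isClosed_closure.isCompact

open unitInterval in
/-- A circle-valued function on the suspension lifts to `Λ_α × [0, 1]`. -/
lemma exists_real_lift_suspension {α : ℝ} (F : Suspension α → AddCircle (1 : ℝ))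
    (hF : Continuous F) :
    ∃ (Θ : I × sturmianZ α → ℝ) (k : sturmianZ α → ℤ), Continuous Θ ∧ Continuous k ∧
      (∀ r x, (Θ (r, x) : AddCircle (1 : ℝ)) = F (Quot.mk _ (x, (r : ℝ)))) ∧
      ∀ x, Θ (1, x) = Θ (0, sturmianShiftZ α x) + k x := by
  have hFc : Continuous fun p : sturmianZ α × ℝ => F (Quot.mk _ p) := hF.comp continuous_quot_mk
  obtain ⟨θ, hθ, hθF⟩ := exists_real_lift_of_totallyDisconnected
    (fun x : sturmianZ α => F (Quot.mk _ (x, 0))) (by fun_prop)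
  let H : C(I × sturmianZ α, AddCircle (1 : ℝ)) :=
    ⟨fun p => F (Quot.mk _ (p.2, (p.1 : ℝ))), by fun_prop⟩
  let Θ := (AddCircle.isCoveringMap_coe (1 : ℝ)).liftHomotopy H ⟨θ, hθ⟩ fun x => by
    simp [H, hθF]
  have hΘ : ∀ p, (Θ p : AddCircle (1 : ℝ)) = F (Quot.mk _ (p.2, (p.1 : ℝ))) :=
    fun p => congr_fun ((AddCircle.isCoveringMap_coe (1 : ℝ)).liftHomotopy_lifts H _ _) p
  have hk : ∀ x, ∃ k : ℤ, Θ (1, x) = Θ (0, sturmianShiftZ α x) + k := by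
    intro x
    have : ((Θ (1, x) - Θ (0, sturmianShiftZ α x) : ℝ) : AddCircle (1 : ℝ)) = 0 := by
      rw [AddCircle.coe_sub, hΘ, hΘ, sub_eq_zero]
      exact congrArg F (Quot.sound ⟨x, 0, by simp, by simp⟩)
    obtain ⟨k, hk⟩ := (AddCircle.coe_eq_zero_iff (1 : ℝ)).1 this
    exact ⟨k, by rw [zsmul_one] at hk; linarith⟩
  choose k hk using hk
  refine ⟨Θ, k, Θ.continuous, ?_, fun r x => hΘ (r, x), hk⟩
  rw [Int.isClosedEmbedding_coe_real.isEmbedding.continuous_iff]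
  have : (Int.cast ∘ k : sturmianZ α → ℝ) = fun x => Θ (1, x) - Θ (0, sturmianShiftZ α x) :=
    funext fun x => by simp [hk]
  rw [this]
  have := continuous_sturmianShiftZ α
  fun_prop

lemma suspension_mk_add_nat {α : ℝ} (x : sturmianZ α) (s : ℝ) (n : ℕ) :
    (Quot.mk _ (x, s + n) : Suspension α) = Quot.mk _ ((sturmianShiftZ α)^[n] x, s) := by
  induction n generalizing x with
  | zero => simp
  | succ n ih =>
    rw [Function.iterate_succ_apply, ← ih]
    exact Quot.sound ⟨x, s + n, by push_cast; rw [add_assoc], rfl⟩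

open unitInterval in
/-- A circle-valued function on the suspension has a winding number along the flow, which belongs
to `ℤ + αℤ`. -/
lemma exists_winding_mem {α : ℝ} (hα : α ∈ Ioo (0 : ℝ) 1) (F : Suspension α → AddCircle (1 : ℝ))
    (hF : Continuous F) : ∃ w ∈ ZplusAZ α, ∀ (u : Suspension α) (g : ℝ → ℝ), Continuous g →
      (∀ s, (g s : AddCircle (1 : ℝ)) = F (suspFlow α s u)) →
        Filter.Tendsto (fun s => g s / s) Filter.atTop (nhds w) := by
  obtain ⟨Θ, k, hΘ, hk, hΘF, hΘk⟩ := exists_real_lift_suspension F hF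
  obtain ⟨w, hw, C, hC⟩ := exists_mean_mem hα k hk
  refine ⟨w, hw, fun u g hg hgF => ?_⟩
  obtain ⟨⟨x, s₀⟩, rfl⟩ := Quot.exists_rep u
  obtain ⟨M, hM⟩ := isCompact_univ.exists_bound_of_continuousOn hΘ.continuousOn
  have hgF' : ∀ s, (g (s - s₀) : AddCircle (1 : ℝ)) = F (Quot.mk _ (x, s)) := fun s => by
    rw [hgF]
    exact congrArg (fun s => F (Quot.mk _ (x, s))) (add_sub_cancel s₀ s)
  let d : ℕ → ℝ := fun n => g (n - s₀) - Θ (0, (sturmianShiftZ α)^[n] x)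
  have hd : ∀ (n : ℕ) (r : I),
      g (r + n - s₀) = Θ (r, (sturmianShiftZ α)^[n] x) + d n := fun n r => by
    have := (AddCircle.isCoveringMap_coe (1 : ℝ)).const_of_comp
      (g := fun r : I => g (r + n - s₀) - Θ (r, (sturmianShiftZ α)^[n] x)) (by fun_prop)
      (fun r r' => by simp [hgF', hΘF, suspension_mk_add_nat]) r 0
    simp only [d]
    simp at this
    linarith
  have hsum : ∀ n, d n = d 0 + ∑ i ∈ Finset.range n, (k ((sturmianShiftZ α)^[i] x) : ℝ) := by
    intro n
    induction n with
    | zero => simp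
    | succ n ih =>
      rw [Finset.sum_range_succ, ← add_assoc, ← ih]
      have h1 := hd n 1
      have h2 := hd (n + 1) 0
      rw [Function.iterate_succ_apply'] at h2
      rw [hΘk, Icc.coe_one, add_comm 1 (n : ℝ)] at h1
      rw [Icc.coe_zero, zero_add] at h2
      push_cast at h2
      linarith
  have hbound : ∀ s, 0 ≤ s → |g (s - s₀) - s * w| ≤ M + |d 0| + C + |w| := by
    intro s hs
    have hn := Nat.floor_le hs
    have hn' := Nat.lt_floor_add_one s
    generalize ⌊s⌋₊ = n at hn hn'
    have h1 := hd n ⟨s - n, by linarith, by linarith⟩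
    rw [hsum] at h1
    simp only [sub_add_cancel] at h1
    have h2 : g (s - s₀) - s * w = Θ (⟨s - n, by linarith, by linarith⟩,
        (sturmianShiftZ α)^[n] x) + d 0 + (∑ i ∈ Finset.range n,
          (k ((sturmianShiftZ α)^[i] x) : ℝ) - n * w) + -((s - n) * w) := by
      rw [h1]; ring
    rw [h2]
    refine (abs_add_le _ _).trans (add_le_add ((abs_add_le _ _).trans (add_le_add
      ((abs_add_le _ _).trans (add_le_add (hM _ (mem_univ _)) le_rfl)) (hC x n))) ?_)
    rw [abs_neg, abs_mul]
    refine mul_le_of_le_one_left (abs_nonneg w) ?_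
    rw [abs_le]
    constructor <;> linarith
  rw [tendsto_iff_dist_tendsto_zero]
  refine squeeze_zero' (Filter.Eventually.of_forall fun _ => dist_nonneg) ?_
    (tendsto_const_nhds.div_atTop Filter.tendsto_id :
      Filter.Tendsto (fun s : ℝ => (M + |d 0| + C + |w| + |s₀ * w|) / s) _ _)
  filter_upwards [Filter.eventually_gt_atTop 0, Filter.eventually_ge_atTop (-s₀)] with s hs hs'
  have h := hbound (s + s₀) (by linarith)
  rw [add_sub_cancel_right] at h
  rw [Real.dist_eq, show g s / s - w = (g s - s * w) / s by field_simp, abs_div, abs_of_pos hs]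
  refine div_le_div_of_nonneg_right ?_ hs.le
  calc |g s - s * w| = |g s - (s + s₀) * w + s₀ * w| := by congr 1; ring
    _ ≤ _ := (abs_add_le _ _).trans (add_le_add h le_rfl)

/-! ### Flow equivalence implies equivalence of the parameters -/

open Filter Topology in
/-- The inverse of the asymptotic rate of a flow equivalence along an orbit. -/
lemma exists_rate_mem {α β : ℝ} (hα : Irrational α) (hαm : α ∈ Ioo (0 : ℝ) 1)
    (hβm : β ∈ Ioo (0 : ℝ) 1) (h : Suspension α ≃ₜ Suspension β) (u : Suspension α) (c : ℝ ≃o ℝ)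
    (hc : ∀ s, h (suspFlow α s u) = suspFlow β (c s) (h u)) :
    ∃ ρ ∈ ZplusAZ β, α * ρ ∈ ZplusAZ β ∧ Tendsto (fun s => c.symm s / s) atTop (𝓝 ρ) := by
  obtain ⟨y, s₀, rfl⟩ := exists_suspend_eq hαm u
  have hc' : ∀ s, h.symm (suspFlow β s (h (y.suspend s₀))) = y.suspend (s₀ + c.symm s) :=
    fun s => by rw [← suspFlow_suspend, h.symm_apply_eq, hc, c.apply_symm_apply]
  have hcont : Continuous c.symm := c.symm.continuous
  have hcoe : Continuous ((↑) : ℝ → AddCircle (1 : ℝ)) := AddCircle.continuous_mk' 1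
  have hpoint := CutLine.continuous_point hα
  have hcast : ∀ (z : ℤ), ((z : ℝ) : AddCircle (1 : ℝ)) = 0 := fun z =>
    (AddCircle.coe_eq_zero_iff 1).2 ⟨z, by simp⟩
  obtain ⟨F₁, hF₁, hF₁'⟩ := exists_continuous_descent hαm
    (fun p : CutLine α × ℝ => (p.2 : AddCircle (1 : ℝ))) (by fun_prop)
    (fun y g s => by simp)
  obtain ⟨F₂, hF₂, hF₂'⟩ := exists_continuous_descent hαm
    (fun p : CutLine α × ℝ => ((p.1.point + α * p.2 : ℝ) : AddCircle (1 : ℝ))) (by fun_prop)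
    (fun y g s => by
      simp only [CutLine.point_translate hα]
      rw [show y.point + latticeVal α g + α * s = y.point + α * (s + g.2) + g.1 by
        rw [latticeVal]; ring, AddCircle.coe_add _ _ (g.1 : ℝ), hcast, add_zero])
  obtain ⟨ρ, hρ, hρ'⟩ := exists_winding_mem hβm (F₁ ∘ h.symm) (hF₁.comp h.symm.continuous)
  obtain ⟨ρ₂, hρ₂, hρ₂'⟩ := exists_winding_mem hβm (F₂ ∘ h.symm) (hF₂.comp h.symm.continuous)
  have h1 := hρ' (h (y.suspend s₀)) (fun s => s₀ + c.symm s) (by fun_prop) fun s => by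
    rw [Function.comp_apply, hc', hF₁']
  have h2 := hρ₂' (h (y.suspend s₀)) (fun s => y.point + α * (s₀ + c.symm s)) (by fun_prop)
    fun s => by rw [Function.comp_apply, hc', hF₂']
  have hzero : ∀ a : ℝ, Tendsto (fun s : ℝ => a / s) atTop (𝓝 0) := fun a =>
    tendsto_const_nhds.div_atTop tendsto_id
  have h3 : Tendsto (fun s => c.symm s / s) atTop (𝓝 ρ) := by
    have := h1.sub (hzero s₀)
    simpa [add_div] using this
  have h4 := ((hzero (y.point + α * s₀)).add (h3.const_mul α))
  have h5 : ρ₂ = α * ρ := by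
    rw [← zero_add (α * ρ)]
    refine tendsto_nhds_unique h2 (h4.congr fun s => ?_)
    ring
  exact ⟨ρ, hρ, h5 ▸ hρ₂, h3⟩

lemma Irrational.intCast_add_mul_eq {α : ℝ} (hα : Irrational α) {m n m' n' : ℤ}
    (h : (m : ℝ) + n * α = m' + n' * α) : m = m' ∧ n = n' := by
  have hn : n = n' := by
    by_contra hne
    refine (irrational_iff_ne_rational α).1 hα (m' - m) (n - n') (sub_ne_zero.2 hne) ?_
    have : ((n : ℝ) - n') ≠ 0 := sub_ne_zero.2 (by exact_mod_cast hne)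
    push_cast
    rw [eq_div_iff this]
    linarith
  subst hn
  exact ⟨by exact_mod_cast add_right_cancel h, rfl⟩

lemma irrationalEquiv_of_mul_eq_one_s7 {α β ρ ρ' : ℝ} (hα : Irrational α) (hρ : ρ ∈ ZplusAZ β)
    (hαρ : α * ρ ∈ ZplusAZ β) (hρ' : ρ' ∈ ZplusAZ α) (hβρ' : β * ρ' ∈ ZplusAZ α)
    (h : ρ * ρ' = 1) : IrrationalEquiv α β := by
  obtain ⟨q, p, hρ⟩ := hρ
  obtain ⟨t, r, hαρ⟩ := hαρ
  obtain ⟨d, c, hρ'⟩ := hρ'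
  obtain ⟨b, a, hβρ'⟩ := hβρ'
  have e1 : ((p * b + q * d : ℤ) : ℝ) + (p * a + q * c : ℤ) * α = (1 : ℤ) + (0 : ℤ) * α := by
    push_cast
    linear_combination h - ρ' * hρ - q * hρ' - p * hβρ'
  have e2 : ((r * b + t * d : ℤ) : ℝ) + (r * a + t * c : ℤ) * α = (0 : ℤ) + (1 : ℤ) * α := by
    push_cast
    linear_combination α * h - ρ' * hαρ - t * hρ' - r * hβρ'
  obtain ⟨h1, h2⟩ := hα.intCast_add_mul_eq e1
  obtain ⟨h3, h4⟩ := hα.intCast_add_mul_eq e2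
  have hdet : (a * d - b * c) * (r * q - t * p) = 1 := by
    linear_combination (p * b + q * d) * h4 + h1 - (r * b + t * d) * h2
  refine ⟨a, b, c, d, Int.isUnit_iff.1 (IsUnit.of_mul_eq_one _ hdet), ?_⟩
  have hne : (c : ℝ) * α + d ≠ 0 := by
    rw [add_comm, ← hρ']
    exact right_ne_zero_of_mul_eq_one h
  rw [eq_div_iff hne]
  linear_combination hβρ' - β * hρ'

open Filter Topology in
lemma irrationalEquiv_of_sturmianFlowEquiv {α β : ℝ} (hα : Irrational α) (hβ : Irrational β)
    (hαm : α ∈ Ioo (0 : ℝ) 1) (hβm : β ∈ Ioo (0 : ℝ) 1) (h : SturmianFlowEquiv α β) :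
    IrrationalEquiv α β := by
  obtain ⟨h, hh⟩ := h
  let u : Suspension α := (CutLine.ofReal α 0).suspend 0
  obtain ⟨c, hmono, hsurj, hc⟩ := hh u
  let e : ℝ ≃o ℝ := hmono.orderIsoOfSurjective c hsurj
  have he : ∀ s, h (suspFlow α s u) = suspFlow β (e s) (h u) := hc
  obtain ⟨ρ, hρ, hαρ, hlim⟩ := exists_rate_mem hα hαm hβm h u e he
  obtain ⟨ρ', hρ', hβρ', hlim'⟩ := exists_rate_mem hβ hβm hαm h.symm (h u) e.symm fun s => by
    rw [h.symm_apply_apply, h.symm_apply_eq, he, e.apply_symm_apply]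
  refine irrationalEquiv_of_mul_eq_one_s7 hα hρ hαρ hρ' hβρ' ?_
  refine tendsto_nhds_unique ((hlim.comp e.tendsto_atTop).mul hlim')
    (tendsto_const_nhds.congr' ?_)
  filter_upwards [eventually_gt_atTop 0, e.tendsto_atTop.eventually_gt_atTop 0] with s hs hs'
  rw [Function.comp_apply, e.symm_apply_apply, OrderIso.symm_symm]
  field_simp

/-- The two-sided Sturmian subshifts `(Λ_α, σ_α)` and `(Λ_β, σ_β)` are flow
equivalent if and only if `α` and `β` are equivalent irrationals. -/
theorem sturmian_flow_equivalence_iff (α β : ℝ) (hα : Irrational α) (hβ : Irrational β)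
    (hαm : α ∈ Set.Ioo (0 : ℝ) 1) (hβm : β ∈ Set.Ioo (0 : ℝ) 1) :
    SturmianFlowEquiv α β ↔ IrrationalEquiv α β := by
  exact ⟨irrationalEquiv_of_sturmianFlowEquiv hα hβ hαm hβm,
    sturmianFlowEquiv_of_irrationalEquiv hα hβ hαm hβm⟩

end
end
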